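/- arXiv:1303.6925 — 3 statements merged into one kernel-verified Lean document; each statement's English description precedes it below -/
import Mathlib

section
/- Let E, S be Polish spaces, η ∈ P(E), ν ∈ P(S), γ ∈ Π(η,ν), and (γ_n) ⊂ P^S(η) a sequence of probabilities on E×S all with first marginal η. Then γ_n converges weakly to γ if and only if for every ν-continuity set A ∈ B(S) (i.e. ν(∂A)=0), the functions Θ_n(A) converge to Θ(A) in the weak topology σ(L¹(η), L^∞(η)), where Θ_n and Θ are the conditional kernels of γ_n and γ with respect to η. -/
open MeasureTheory ProbabilityTheory Filter Set Topology

noncomputable section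

/-- The augmentation of a sub-σ-field `m` by the `η`-null sets. -/
def aug {α : Type*} [MeasurableSpace α] (η : Measure α) (m : MeasurableSpace α) :
    MeasurableSpace α :=
  m ⊔ MeasurableSpace.generateFrom {s : Set α | η s = 0}

/-- `Θ` is a conditional probability kernel of `γ` with respect to `η`. -/
def IsCondKernel {E S : Type*} [MeasurableSpace E] [MeasurableSpace S]
    (η : Measure E) (γ : Measure (E × S)) (Θ : Kernel E S) : Prop :=
  IsMarkovKernel Θ ∧ ∀ A B, MeasurableSet A → MeasurableSet B →
    γ (A ×ˢ B) = ∫⁻ ω in A, Θ ω B ∂η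

/-- A plan `γ` on `E × S` with first marginal `η` is causal for the filtrations
`ℱE`, `ℱS` if it admits a conditional kernel `Θ` with respect to `η` such that for every
`t` and every `C ∈ ℱS t`, `ω ↦ Θ ω C` is measurable for the `η`-augmentation of `ℱE t`. -/
def CausalPlan {E S : Type*} [MeasurableSpace E] [MeasurableSpace S]
    (ℱE : unitInterval → MeasurableSpace E) (ℱS : unitInterval → MeasurableSpace S)
    (η : Measure E) (γ : Measure (E × S)) : Prop :=
  γ.fst = η ∧ ∃ Θ : Kernel E S, IsCondKernel η γ Θ ∧
    ∀ t : unitInterval, ∀ C : Set S, MeasurableSet[ℱS t] C →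
      Measurable[aug η (ℱE t)] (fun ω => Θ ω C)

/-- In a pseudometrizable space every neighbourhood contains an open neighbourhood
whose frontier is null. -/
lemma exists_isOpen_null_frontier {X : Type*} [MeasurableSpace X] [TopologicalSpace X]
    [TopologicalSpace.PseudoMetrizableSpace X] [OpensMeasurableSpace X]
    (μ : Measure X) [SFinite μ] {x : X} {u : Set X} (hu : IsOpen u) (hx : x ∈ u) :
    ∃ v, IsOpen v ∧ μ (frontier v) = 0 ∧ x ∈ v ∧ v ⊆ u := by
  let _ := TopologicalSpace.pseudoMetrizableSpacePseudoMetric X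
  obtain ⟨ε, hε, hball⟩ := Metric.isOpen_iff.1 hu x hx
  obtain ⟨r, ⟨hr, hrε⟩, hnull⟩ := exists_null_frontier_thickening μ {x} hε
  rw [Metric.thickening_singleton] at hnull
  exact ⟨Metric.ball x r, Metric.isOpen_ball, hnull, Metric.mem_ball_self hr,
    (Metric.ball_subset_ball hrε.le).trans hball⟩

lemma isPiSystem_isOpen_null_frontier {X : Type*} [MeasurableSpace X] [TopologicalSpace X]
    (μ : Measure X) : IsPiSystem {v : Set X | IsOpen v ∧ μ (frontier v) = 0} := by
  rintro s ⟨hs, hs0⟩ t ⟨ht, ht0⟩ -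
  refine ⟨hs.inter ht, measure_mono_null (frontier_inter_subset s t) ?_⟩
  exact measure_union_null (measure_mono_null inter_subset_left hs0)
    (measure_mono_null inter_subset_right ht0)

lemma generateFrom_isOpen_null_frontier {X : Type*} [MeasurableSpace X] [TopologicalSpace X]
    [TopologicalSpace.PseudoMetrizableSpace X] [SecondCountableTopology X] [BorelSpace X]
    (μ : Measure X) [SFinite μ] :
    ‹MeasurableSpace X› =
      MeasurableSpace.generateFrom {v : Set X | IsOpen v ∧ μ (frontier v) = 0} := by
  have hbasis : TopologicalSpace.IsTopologicalBasis
      {v : Set X | IsOpen v ∧ μ (frontier v) = 0} :=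
    TopologicalSpace.isTopologicalBasis_of_isOpen_of_nhds (fun v hv => hv.1) fun x u hx hu => by
      obtain ⟨v, hv, hv0, hxv, hvu⟩ := exists_isOpen_null_frontier μ hu hx
      exact ⟨v, ⟨hv, hv0⟩, hxv, hvu⟩
  rw [← hbasis.borel_eq_generateFrom]
  exact BorelSpace.measurable_eq

/-- For measures dominated by a common finite measure, convergence on a generating π-system and
of the total masses implies convergence on all measurable sets. -/
lemma tendsto_measureReal_of_isPiSystem_of_le {X : Type*} [m : MeasurableSpace X]
    {η : Measure X} [IsFiniteMeasure η] {ρseq : ℕ → Measure X} {ρ : Measure X}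
    (hle : ∀ n, ρseq n ≤ η) (hρ : ρ ≤ η) {C : Set (Set X)}
    (hgen : m = MeasurableSpace.generateFrom C) (hC : IsPiSystem C)
    (huniv : Tendsto (fun n => (ρseq n).real univ) atTop (𝓝 (ρ.real univ)))
    (h : ∀ s ∈ C, Tendsto (fun n => (ρseq n).real s) atTop (𝓝 (ρ.real s)))
    {B : Set X} (hB : MeasurableSet B) :
    Tendsto (fun n => (ρseq n).real B) atTop (𝓝 (ρ.real B)) := by
  have hfin (n : ℕ) : IsFiniteMeasure (ρseq n) := isFiniteMeasure_of_le η (hle n)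
  have : IsFiniteMeasure ρ := isFiniteMeasure_of_le η hρ
  induction B, hB using MeasurableSpace.induction_on_inter hgen hC with
  | empty => simp
  | basic t ht => exact h t ht
  | compl t ht ih =>
    simp only [measureReal_compl ht]
    exact huniv.sub ih
  | iUnion f hdisj hf ih =>
    have key (μ : Measure X) [IsFiniteMeasure μ] :
        HasSum (fun i => μ.real (f i)) (μ.real (⋃ i, f i)) := by
      have hne : ∑' i, μ (f i) ≠ ⊤ := by
        rw [← measure_iUnion hdisj hf]; exact measure_ne_top _ _
      simp only [measureReal_def]
      rw [measure_iUnion hdisj hf]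
      rw [ENNReal.tsum_toReal_eq fun i => measure_ne_top _ _]
      exact ENNReal.hasSum_toReal hne
    simp only [← (key _).tsum_eq]
    refine tendsto_tsum_of_dominated_convergence (key η).summable ih
      (Eventually.of_forall fun n i => ?_)
    rw [Real.norm_of_nonneg measureReal_nonneg]
    exact ENNReal.toReal_mono (measure_ne_top _ _) (hle n _)

/-- For measures dominated by a common finite measure `η`, setwise convergence implies
convergence of the integrals of `η`-integrable functions. -/
lemma tendsto_integral_of_tendsto_measureReal_of_le {X : Type*} [MeasurableSpace X]
    {η : Measure X} [IsFiniteMeasure η] {ρseq : ℕ → Measure X} {ρ : Measure X}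
    (hle : ∀ n, ρseq n ≤ η) (hρ : ρ ≤ η)
    (h : ∀ B, MeasurableSet B → Tendsto (fun n => (ρseq n).real B) atTop (𝓝 (ρ.real B)))
    {f : X → ℝ} (hf : Integrable f η) :
    Tendsto (fun n => ∫ x, f x ∂(ρseq n)) atTop (𝓝 (∫ x, f x ∂ρ)) := by
  refine Integrable.induction
    (fun f => Tendsto (fun n => ∫ x, f x ∂(ρseq n)) atTop (𝓝 (∫ x, f x ∂ρ)))
    (fun c s hs _ => ?_) (fun f g _ hf hg ihf ihg => ?_) ?_ (fun f g hfg _ ih => ?_) hf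
  · simp only [integral_indicator_const _ hs, smul_eq_mul]
    exact (h s hs).mul_const c
  · simp only [Pi.add_apply]
    rw [integral_add (hf.mono_measure hρ) (hg.mono_measure hρ)]
    simp_rw [fun n => integral_add (hf.mono_measure (hle n)) (hg.mono_measure (hle n))]
    exact ihf.add ihg
  · have hdist (μ : Measure X) (hμ : μ ≤ η) (f g : X →₁[η] ℝ) :
        dist (∫ x, f x ∂μ) (∫ x, g x ∂μ) ≤ dist f g := by
      have hf := L1.integrable_coeFn f
      have hg := L1.integrable_coeFn g
      rw [dist_eq_norm, ← integral_sub (hf.mono_measure hμ) (hg.mono_measure hμ),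
        L1.dist_eq_integral_dist]
      simp only [dist_eq_norm]
      exact (norm_integral_le_integral_norm _).trans
        (integral_mono_measure hμ (Eventually.of_forall fun _ => norm_nonneg _) (hf.sub hg).norm)
    refine isClosed_of_closure_subset fun f hf => Metric.tendsto_atTop.2 fun ε hε => ?_
    obtain ⟨g, hg, hfg⟩ := Metric.mem_closure_iff.1 hf (ε / 3) (by positivity)
    obtain ⟨N, hN⟩ := Metric.tendsto_atTop.1 hg (ε / 3) (by positivity)
    refine ⟨N, fun n hn => ?_⟩
    have h₁ := hdist _ (hle n) f g
    have h₂ := hdist _ hρ g f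
    rw [dist_comm g f] at h₂
    linarith [hN n hn, dist_triangle4 (∫ x, f x ∂(ρseq n)) (∫ x, g x ∂(ρseq n))
      (∫ x, g x ∂ρ) (∫ x, f x ∂ρ)]
  · rw [← integral_congr_ae (ae_mono hρ hfg)]
    simp_rw [← fun n => integral_congr_ae (ae_mono (hle n) hfg)]
    exact ih

lemma withDensity_kernel_le {E S : Type*} [MeasurableSpace E] [MeasurableSpace S]
    (η : Measure E) (Θ : Kernel E S) [IsMarkovKernel Θ] (A : Set S) :
    η.withDensity (fun ω => Θ ω A) ≤ η := by
  conv_rhs => rw [← withDensity_one (μ := η)]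
  exact withDensity_mono (Eventually.of_forall fun ω => prob_le_one)

lemma integral_withDensity_kernel {E S : Type*} [MeasurableSpace E] [MeasurableSpace S]
    (η : Measure E) (Θ : Kernel E S) [IsMarkovKernel Θ] {A : Set S} (hA : MeasurableSet A)
    (X : E → ℝ) :
    ∫ ω, X ω ∂(η.withDensity fun ω => Θ ω A) = ∫ ω, X ω * (Θ ω A).toReal ∂η := by
  rw [integral_withDensity_eq_integral_toReal_smul (Θ.measurable_coe hA)
    (Eventually.of_forall fun ω => measure_lt_top _ _)]
  simp only [smul_eq_mul, mul_comm]

lemma IsCondKernel.measureReal_prod {E S : Type*} [MeasurableSpace E] [MeasurableSpace S]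
    {η : Measure E} {γ : Measure (E × S)} {Θ : Kernel E S} (hΘ : IsCondKernel η γ Θ)
    {A : Set S} (hA : MeasurableSet A) {B : Set E} (hB : MeasurableSet B) :
    (η.withDensity fun ω => Θ ω A).real B = γ.real (B ×ˢ A) := by
  rw [measureReal_def, measureReal_def, withDensity_apply _ hB, hΘ.2 B A hB hA]

lemma null_frontier_prod {E S : Type*} [MeasurableSpace E] [TopologicalSpace E]
    [OpensMeasurableSpace E] [MeasurableSpace S] [TopologicalSpace S] [OpensMeasurableSpace S]
    {γ : Measure (E × S)} {B : Set E} {A : Set S}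
    (hB : γ.fst (frontier B) = 0) (hA : γ.snd (frontier A) = 0) :
    γ (frontier (B ×ˢ A)) = 0 := by
  rw [Measure.fst_apply isClosed_frontier.measurableSet] at hB
  rw [Measure.snd_apply isClosed_frontier.measurableSet] at hA
  rw [frontier_prod_eq]
  exact measure_union_null (measure_mono_null (fun x hx => hx.2) hA)
    (measure_mono_null (fun x hx => hx.1) hB)

/-- `γ_n → γ` weakly iff for every `ν`-continuity set `A ∈ B(S)`, the kernel
functions `Θ_n(A)` converge to `Θ(A)` in the weak topology `σ(L¹(η), L^∞(η))`. -/
theorem weak_convergence_iff_kernel_convergence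
    {E S : Type*} [MeasurableSpace E] [TopologicalSpace E] [PolishSpace E] [BorelSpace E]
    [MeasurableSpace S] [TopologicalSpace S] [PolishSpace S] [BorelSpace S]
    (η : Measure E) [IsProbabilityMeasure η] (ν : Measure S) [IsProbabilityMeasure ν]
    (γseq : ℕ → Measure (E × S)) (hprob : ∀ n, IsProbabilityMeasure (γseq n))
    (hfst : ∀ n, (γseq n).fst = η)
    (γ : Measure (E × S)) [IsProbabilityMeasure γ] (hγfst : γ.fst = η) (hγsnd : γ.snd = ν)
    (Θseq : ℕ → Kernel E S) (hΘseq : ∀ n, IsCondKernel η (γseq n) (Θseq n))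
    (Θ : Kernel E S) (hΘ : IsCondKernel η γ Θ) :
    (∀ f : BoundedContinuousFunction (E × S) ℝ,
        Tendsto (fun n => ∫ x, f x ∂(γseq n)) atTop (𝓝 (∫ x, f x ∂γ))) ↔
      (∀ A : Set S, MeasurableSet A → ν (frontier A) = 0 →
        ∀ X : E → ℝ, Measurable X → (∃ C : ℝ, ∀ ω, |X ω| ≤ C) →
          Tendsto (fun n => ∫ ω, X ω * (Θseq n ω A).toReal ∂η) atTop
            (𝓝 (∫ ω, X ω * (Θ ω A).toReal ∂η))) := by
  have hM (n : ℕ) : IsMarkovKernel (Θseq n) := (hΘseq n).1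
  have : IsMarkovKernel Θ := hΘ.1
  let P : ℕ → ProbabilityMeasure (E × S) := fun n => ⟨γseq n, hprob n⟩
  let Q : ProbabilityMeasure (E × S) := ⟨γ, inferInstance⟩
  have hweak : (∀ f : BoundedContinuousFunction (E × S) ℝ,
      Tendsto (fun n => ∫ x, f x ∂(γseq n)) atTop (𝓝 (∫ x, f x ∂γ))) ↔
      Tendsto P atTop (𝓝 Q) :=
    (ProbabilityMeasure.tendsto_iff_forall_integral_tendsto (μs := P) (μ := Q)).symm
  rw [hweak]
  constructor
  · intro hlim A hA hA0 X hX ⟨C, hC⟩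
    have hrect (B : Set E) (hB : MeasurableSet B) (hB0 : η (frontier B) = 0) :
        Tendsto (fun n => (η.withDensity fun ω => Θseq n ω A).real B) atTop
          (𝓝 ((η.withDensity fun ω => Θ ω A).real B)) := by
      simp only [hΘ.measureReal_prod hA hB, (hΘseq _).measureReal_prod hA hB]
      exact (ENNReal.tendsto_toReal (measure_ne_top _ _)).comp
        (ProbabilityMeasure.tendsto_measure_of_null_frontier_of_tendsto' hlim
          (null_frontier_prod (γ := γ) (hγfst ▸ hB0) (hγsnd ▸ hA0)))
    have hle (n : ℕ) := withDensity_kernel_le η (Θseq n) A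
    have hle' := withDensity_kernel_le η Θ A
    simp only [← integral_withDensity_kernel η _ hA]
    refine tendsto_integral_of_tendsto_measureReal_of_le hle hle' (fun B hB => ?_)
      (Integrable.of_bound hX.aestronglyMeasurable C (Eventually.of_forall hC))
    exact tendsto_measureReal_of_isPiSystem_of_le hle hle' (generateFrom_isOpen_null_frontier η)
      (isPiSystem_isOpen_null_frontier η) (hrect univ .univ (by simp))
      (fun s hs => hrect s hs.1.measurableSet hs.2) hB
  · intro h
    refine ((isPiSystem_isOpen_null_frontier η).prod
      (isPiSystem_isOpen_null_frontier ν)).tendsto_probabilityMeasure_of_tendsto_of_mem ?_ ?_ ?_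
    · rintro _ ⟨B, hB, A, hA, rfl⟩
      exact hB.1.measurableSet.prod hA.1.measurableSet
    · rintro u hu ⟨x, y⟩ hxy
      obtain ⟨U, V, hU, hV, hxU, hyV, hUV⟩ := isOpen_prod_iff.1 hu x y hxy
      obtain ⟨B, hB, hB0, hxB, hBU⟩ := exists_isOpen_null_frontier η hU hxU
      obtain ⟨A, hA, hA0, hyA, hAV⟩ := exists_isOpen_null_frontier ν hV hyV
      exact ⟨B ×ˢ A, ⟨B, ⟨hB, hB0⟩, A, ⟨hA, hA0⟩, rfl⟩,
        (hB.prod hA).mem_nhds ⟨hxB, hyA⟩, (prod_mono hBU hAV).trans hUV⟩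
    · rintro _ ⟨B, ⟨hB, -⟩, A, ⟨hA, hA0⟩, rfl⟩
      have hBm := hB.measurableSet
      have hAm := hA.measurableSet
      have key := h A hAm hA0 (B.indicator 1) (measurable_one.indicator hBm)
        ⟨1, fun ω => by by_cases hω : ω ∈ B <;> simp [hω]⟩
      simp only [← integral_withDensity_kernel η _ hAm, integral_indicator_one hBm,
        hΘ.measureReal_prod hAm hBm, (hΘseq _).measureReal_prod hAm hBm] at key
      exact NNReal.tendsto_coe.1 key
end
end

section
/- Let E, S be filtered Polish spaces, η ∈ P(E), ν ∈ P(S). The set Π_c(η,ν) of causal transference plans with marginals η and ν is nonempty, convex, and compact in P(E×S) for the topology of weak convergence of probability measures. In particular, the product measure η ⊗ ν lies in Π_c(η,ν). -/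
open MeasureTheory ProbabilityTheory Filter Set Topology
open scoped ENNReal NNReal

noncomputable section

/-- The augmentation of `m` consists of the sets that agree `η`-a.e. with a set of `m`. -/
lemma aug_eq_eventuallyMeasurableSpace {α : Type*} (m : MeasurableSpace α)
    [MeasurableSpace α] (η : Measure α) : aug η m = eventuallyMeasurableSpace m (ae η) := by
  apply le_antisymm
  · refine sup_le le_eventuallyMeasurableSpace (MeasurableSpace.generateFrom_le fun s hs => ?_)
    exact ⟨∅, MeasurableSpace.measurableSet_empty m, ae_eq_empty.2 hs⟩
  · rintro s ⟨t, ht, hst⟩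
    have hN : MeasurableSet[aug η m] (symmDiff s t) :=
      (le_sup_right : MeasurableSpace.generateFrom {s : Set α | η s = 0} ≤ aug η m) _
        (MeasurableSpace.measurableSet_generateFrom (measure_symmDiff_eq_zero_iff.2 hst))
    have hs : s = symmDiff t (symmDiff s t) := by
      rw [symmDiff_comm s t, symmDiff_symmDiff_cancel_left]
    rw [hs]
    exact MeasurableSet.symmDiff ((le_sup_left : _ ≤ aug η m) _ ht) hN

lemma measurable_aug_iff {α : Type*} {m : MeasurableSpace α}
    [MeasurableSpace α] {η : Measure α} {f : α → ℝ≥0∞} :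
    Measurable[aug η m] f ↔ ∃ g, Measurable[m] g ∧ f =ᵐ[η] g := by
  rw [aug_eq_eventuallyMeasurableSpace]
  constructor
  · intro hf
    refine Measurable.ennreal_induction (motive := fun f => ∃ g, Measurable[m] g ∧ f =ᵐ[η] g)
      ?_ ?_ ?_ hf
    · rintro c s ⟨t, ht, hst⟩
      exact ⟨t.indicator fun _ => c, measurable_const.indicator ht,
        indicator_ae_eq_of_ae_eq_set hst⟩
    · rintro _ _ - - - ⟨f', hf', hff'⟩ ⟨g', hg', hgg'⟩
      exact ⟨f' + g', hf'.add hg', hff'.add hgg'⟩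
    · intro _ _ _ h
      choose g hg hfg using h
      refine ⟨fun x => ⨆ n, g n x, Measurable.iSup hg, ?_⟩
      filter_upwards [ae_all_iff.2 hfg] with x hx
      simp only [hx]
  · rintro ⟨g, hg, hfg⟩
    exact hg.eventuallyMeasurable_of_eventuallyEq hfg

lemma measurable_aug_iff_aestronglyMeasurable_toReal {α : Type*}
    {m : MeasurableSpace α} [MeasurableSpace α] {η : Measure α} {f : α → ℝ≥0∞} (hf : ∀ x, f x ≠ ∞) :
    Measurable[aug η m] f ↔ AEStronglyMeasurable[m] (fun x => (f x).toReal) η := by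
  rw [measurable_aug_iff]
  constructor
  · rintro ⟨g, hg, hfg⟩
    refine ⟨fun x => (g x).toReal, hg.ennreal_toReal.stronglyMeasurable, ?_⟩
    filter_upwards [hfg] with x hx
    rw [hx]
  · rintro ⟨g, hg, hfg⟩
    refine ⟨fun x => ENNReal.ofReal (g x), hg.measurable.ennreal_ofReal, ?_⟩
    filter_upwards [hfg] with x hx
    rw [← hx, ENNReal.ofReal_toReal (hf x)]

/-- Conditional expectation is self-adjoint. -/
lemma integral_condExp_mul_eq {α : Type*} {m m₀ : MeasurableSpace α} {η : Measure α}
    [IsFiniteMeasure η] (hm : m ≤ m₀) {f g : α → ℝ} {R : ℝ≥0} (hf : Integrable f η)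
    (hg : AEStronglyMeasurable g η) (hgR : ∀ᵐ x ∂η, |g x| ≤ R) :
    ∫ x, (η[f|m]) x * g x ∂η = ∫ x, f x * (η[g|m]) x ∂η := by
  have hgi : Integrable g η := .of_bound hg R hgR
  have h₁ : Integrable (η[f|m] * g) η := integrable_condExp.mul_bdd hg hgR
  have h₂ : Integrable (f * η[g|m]) η :=
    hf.mul_bdd integrable_condExp.aestronglyMeasurable (ae_bdd_abs_condExp_of_ae_bdd_abs hgR)
  calc ∫ x, (η[f|m]) x * g x ∂η = ∫ x, (η[η[f|m] * g|m]) x ∂η := (integral_condExp hm).symm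
    _ = ∫ x, (η[f|m] * η[g|m]) x ∂η :=
      integral_congr_ae (condExp_mul_of_stronglyMeasurable_left stronglyMeasurable_condExp h₁ hgi)
    _ = ∫ x, (η[f * η[g|m]|m]) x ∂η :=
      (integral_congr_ae
        (condExp_mul_of_stronglyMeasurable_right stronglyMeasurable_condExp h₂ hf)).symm
    _ = ∫ x, f x * (η[g|m]) x ∂η := integral_condExp hm

/-- The part of the indicator of `A` that is orthogonal to the `m`-measurable functions. -/
def indicatorResidual {α : Type*} (m : MeasurableSpace α) [MeasurableSpace α] (η : Measure α)
    (A : Set α) : α → ℝ :=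
  A.indicator 1 - η[A.indicator 1|m]

lemma integrable_indicatorResidual {α : Type*} (m : MeasurableSpace α) [MeasurableSpace α]
    (η : Measure α) [IsFiniteMeasure η] {A : Set α} (hA : MeasurableSet A) :
    Integrable (indicatorResidual m η A) η :=
  ((integrable_const (1 : ℝ)).indicator hA).sub integrable_condExp

lemma aestronglyMeasurable_iff_integral_indicatorResidual_eq_zero {α : Type*}
    {m m₀ : MeasurableSpace α} {η : Measure α} [IsFiniteMeasure η] (hm : m ≤ m₀) {k : α → ℝ}
    {R : ℝ≥0} (hk : AEStronglyMeasurable k η) (hkR : ∀ᵐ x ∂η, |k x| ≤ R) :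
    AEStronglyMeasurable[m] k η ↔
      ∀ A, MeasurableSet A → ∫ x, indicatorResidual m η A x * k x ∂η = 0 := by
  have hki : Integrable k η := .of_bound hk R hkR
  have key (A : Set α) (hA : MeasurableSet A) : ∫ x, indicatorResidual m η A x * k x ∂η =
      ∫ x in A, k x ∂η - ∫ x in A, (η[k|m]) x ∂η := by
    have hi : Integrable (A.indicator (1 : α → ℝ)) η := (integrable_const (1 : ℝ)).indicator hA
    have hmul (h : α → ℝ) : ∫ x, A.indicator 1 x * h x ∂η = ∫ x in A, h x ∂η := by
      rw [← integral_indicator hA]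
      congr with x
      by_cases hx : x ∈ A <;> simp [hx]
    rw [← hmul k, ← hmul (η[k|m]), ← integral_condExp_mul_eq hm hi hk hkR,
      ← integral_sub (hi.mul_bdd hk hkR) (integrable_condExp.mul_bdd hk hkR)]
    simp [indicatorResidual, sub_mul]
  constructor
  · intro h A hA
    rw [key A hA, sub_eq_zero]
    exact integral_congr_ae (ae_restrict_of_ae (condExp_of_aestronglyMeasurable' hm h hki).symm)
  · intro h
    have : k =ᵐ[η] η[k|m] := hki.ae_eq_of_forall_setIntegral_eq _ _ integrable_condExp
      fun A hA _ => sub_eq_zero.1 ((key A hA).symm.trans (h A hA))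
    exact ⟨η[k|m], stronglyMeasurable_condExp, this⟩

lemma IsCondKernel.eq_compProd {E S : Type*} [MeasurableSpace E] [MeasurableSpace S]
    {η : Measure E} [IsFiniteMeasure η] {γ : Measure (E × S)} [IsFiniteMeasure γ]
    {Θ : Kernel E S} (h : IsCondKernel η γ Θ) : γ = η ⊗ₘ Θ := by
  have := h.1
  refine Measure.ext_prod fun {A B} hA hB => ?_
  rw [h.2 A B hA hB, Measure.compProd_apply_prod hA hB]

lemma isCondKernel_condKernel {E S : Type*} [MeasurableSpace E] [MeasurableSpace S]
    [StandardBorelSpace S] [Nonempty S] {γ : Measure (E × S)} [IsFiniteMeasure γ] :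
    IsCondKernel γ.fst γ γ.condKernel := by
  refine ⟨inferInstance, fun A B hA hB => ?_⟩
  rw [← Measure.compProd_apply_prod hA hB, γ.disintegrate]

lemma integrable_fst_mul_indicator_snd {E S : Type*} [MeasurableSpace E] [MeasurableSpace S]
    {γ : Measure (E × S)} {f : E → ℝ} (hf : Integrable f γ.fst) {C : Set S}
    (hC : MeasurableSet C) :
    Integrable (fun z : E × S => f z.1 * C.indicator 1 z.2) γ := by
  refine (hf.comp_measurable measurable_fst).mul_bdd (c := 1) ?_ (ae_of_all _ fun z => ?_)
  · exact ((measurable_one.indicator hC).comp measurable_snd).aestronglyMeasurable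
  · by_cases hz : z.2 ∈ C <;> simp [hz]

lemma IsCondKernel.integral_fst_mul_indicator_snd {E S : Type*} [MeasurableSpace E]
    [MeasurableSpace S] {η : Measure E} [IsFiniteMeasure η] {γ : Measure (E × S)}
    [IsFiniteMeasure γ] {Θ : Kernel E S} (h : IsCondKernel η γ Θ) {f : E → ℝ}
    (hf : Integrable f η) {C : Set S} (hC : MeasurableSet C) :
    ∫ z, f z.1 * C.indicator 1 z.2 ∂γ = ∫ x, f x * (Θ x C).toReal ∂η := by
  have := h.1
  have hγ := h.eq_compProd
  have hfst : γ.fst = η := by rw [hγ, Measure.fst_compProd]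
  have hint := integrable_fst_mul_indicator_snd (γ := γ) (hfst ▸ hf) hC
  rw [hγ] at hint ⊢
  rw [Measure.integral_compProd hint]
  congr with x
  dsimp only
  rw [integral_const_mul, integral_indicator_one hC, Measure.real]

/-- A plan is causal if and only if it annihilates a family of test functions of product form. -/
lemma causalPlan_iff {E S : Type*} [MeasurableSpace E] [MeasurableSpace S]
    [StandardBorelSpace S] {ℱE : unitInterval → MeasurableSpace E}
    {ℱS : unitInterval → MeasurableSpace S} (hleE : ∀ t, ℱE t ≤ ‹MeasurableSpace E›)
    (hleS : ∀ t, ℱS t ≤ ‹MeasurableSpace S›) {η : Measure E} [IsFiniteMeasure η]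
    {γ : Measure (E × S)} [IsProbabilityMeasure γ] :
    CausalPlan ℱE ℱS η γ ↔ γ.fst = η ∧ ∀ t C, MeasurableSet[ℱS t] C → ∀ A, MeasurableSet A →
      ∫ z, indicatorResidual (ℱE t) η A z.1 * C.indicator 1 z.2 ∂γ = 0 := by
  have key {Θ : Kernel E S} (hΘ : IsCondKernel η γ Θ) (t : unitInterval) (C : Set S)
      (hC : MeasurableSet[ℱS t] C) : Measurable[aug η (ℱE t)] (fun ω => Θ ω C) ↔
      ∀ A, MeasurableSet A →
        ∫ z, indicatorResidual (ℱE t) η A z.1 * C.indicator 1 z.2 ∂γ = 0 := by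
    have := hΘ.1
    have hC' := hleS t C hC
    rw [measurable_aug_iff_aestronglyMeasurable_toReal fun x => measure_ne_top _ _,
      aestronglyMeasurable_iff_integral_indicatorResidual_eq_zero (R := 1) (hleE t)
        (Θ.measurable_coe hC').ennreal_toReal.aestronglyMeasurable
        (ae_of_all _ fun x => by
          rw [abs_of_nonneg ENNReal.toReal_nonneg]
          exact measureReal_le_one)]
    refine forall₂_congr fun A hA => ?_
    rw [hΘ.integral_fst_mul_indicator_snd (integrable_indicatorResidual _ η hA) hC']
  refine and_congr_right fun hfst => ⟨?_, fun h => ?_⟩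
  · rintro ⟨Θ, hΘ, h⟩ t C hC
    exact (key hΘ t C hC).1 (h t C hC)
  · have : Nonempty S := (nonempty_of_isProbabilityMeasure γ).map Prod.snd
    have hΘ : IsCondKernel η γ γ.condKernel := hfst ▸ isCondKernel_condKernel (γ := γ)
    exact ⟨_, hΘ, fun t C hC => (key hΘ t C hC).2 (h t C hC)⟩

/-- The couplings of `η` and `ν`, in the space of probability measures. -/
def couplings {E S : Type*} [MeasurableSpace E] [MeasurableSpace S] (η : Measure E)
    (ν : Measure S) : Set (ProbabilityMeasure (E × S)) :=
  {γ | (γ : Measure (E × S)).fst = η ∧ (γ : Measure (E × S)).snd = ν}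

lemma isClosed_couplings {E S : Type*} [MeasurableSpace E] [TopologicalSpace E]
    [PolishSpace E] [BorelSpace E] [MeasurableSpace S] [TopologicalSpace S] [PolishSpace S]
    [BorelSpace S] (η : Measure E) [IsProbabilityMeasure η] (ν : Measure S)
    [IsProbabilityMeasure ν] : IsClosed (couplings η ν) := by
  have h₁ := isClosed_eq (ProbabilityMeasure.continuous_map (continuous_fst (X := E) (Y := S)))
    (@continuous_const _ (ProbabilityMeasure E) _ _ ⟨η, inferInstance⟩)
  have h₂ := isClosed_eq (ProbabilityMeasure.continuous_map (continuous_snd (X := E) (Y := S)))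
    (@continuous_const _ (ProbabilityMeasure S) _ _ ⟨ν, inferInstance⟩)
  convert! h₁.inter h₂ using 1
  ext γ
  exact and_congr (Subtype.ext_iff (a1 := γ.map _) (a2 := ⟨η, inferInstance⟩)).symm
    (Subtype.ext_iff (a1 := γ.map _) (a2 := ⟨ν, inferInstance⟩)).symm

lemma isCompact_couplings {E S : Type*} [MeasurableSpace E] [TopologicalSpace E]
    [PolishSpace E] [BorelSpace E] [MeasurableSpace S] [TopologicalSpace S] [PolishSpace S]
    [BorelSpace S] (η : Measure E) [IsProbabilityMeasure η] (ν : Measure S)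
    [IsProbabilityMeasure ν] : IsCompact (couplings η ν) := by
  rw [← (isClosed_couplings η ν).closure_eq]
  apply isCompact_closure_of_isTightMeasureSet
  refine IsTightMeasureSet.prodMk (isTightMeasureSet_singleton (μ := η).subset ?_)
    (isTightMeasureSet_singleton (μ := ν).subset ?_)
  · rintro _ ⟨_, ⟨γ, hγ, rfl⟩, rfl⟩
    exact hγ.1
  · rintro _ ⟨_, ⟨γ, hγ, rfl⟩, rfl⟩
    exact hγ.2

/-- On the couplings of `η` and `ν`, integrals of products of an `η`-integrable function of the
first variable and an indicator function of the second depend continuously on the plan. -/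
lemma continuousOn_integral_fst_mul_indicator_snd {E S : Type*} [MeasurableSpace E]
    [TopologicalSpace E] [PolishSpace E] [BorelSpace E] [MeasurableSpace S] [TopologicalSpace S]
    [PolishSpace S] [BorelSpace S] {η : Measure E} [IsFiniteMeasure η] {ν : Measure S}
    [IsFiniteMeasure ν] {f : E → ℝ} (hf : Integrable f η) {C : Set S} (hC : MeasurableSet C) :
    ContinuousOn (fun γ : ProbabilityMeasure (E × S) =>
      ∫ z, f z.1 * C.indicator 1 z.2 ∂(γ : Measure (E × S))) (couplings η ν) := by
  refine continuousOn_of_uniform_approx_of_continuousOn fun u hu => ?_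
  obtain ⟨ε, hε, hεu⟩ := Metric.mem_uniformity_dist.1 hu
  obtain ⟨f', hff', hf'⟩ := hf.exists_boundedContinuous_integral_sub_le (half_pos (half_pos hε))
  have hM : 0 < ‖f'‖ + 1 := by positivity
  have hi : Integrable (C.indicator (1 : S → ℝ)) ν := (integrable_const (1 : ℝ)).indicator hC
  obtain ⟨g', hgg', hg'⟩ :=
    hi.exists_boundedContinuous_integral_sub_le (ε := ε / 2 / (‖f'‖ + 1)) (by positivity)
  let F : BoundedContinuousFunction (E × S) ℝ :=
    f'.compContinuous ⟨Prod.fst, continuous_fst⟩ * g'.compContinuous ⟨Prod.snd, continuous_snd⟩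
  refine ⟨fun γ => ∫ z, F z ∂(γ : Measure (E × S)),
    (ProbabilityMeasure.continuous_integral_boundedContinuousFunction F).continuousOn,
    fun γ hγ => hεu ?_⟩
  obtain ⟨hfst, hsnd⟩ := hγ
  have hfi : Integrable (fun z : E × S => ‖f z.1 - f' z.1‖) (γ : Measure (E × S)) := by
    have h := (hf.sub hf').norm
    rw [← hfst] at h
    exact h.comp_measurable measurable_fst
  have hgi : Integrable (fun z : E × S => ‖C.indicator 1 z.2 - g' z.2‖)
      (γ : Measure (E × S)) := by
    have h := (hi.sub hg').norm
    rw [← hsnd] at h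
    exact h.comp_measurable measurable_snd
  have hfeq : ∫ z, ‖f z.1 - f' z.1‖ ∂(γ : Measure (E × S)) = ∫ x, ‖f x - f' x‖ ∂η := by
    have h := (hf.sub hf').norm.aestronglyMeasurable
    rw [← hfst] at h ⊢
    exact (integral_map measurable_fst.aemeasurable h).symm
  have hgeq : ∫ z, ‖C.indicator 1 z.2 - g' z.2‖ ∂(γ : Measure (E × S)) =
      ∫ y, ‖C.indicator 1 y - g' y‖ ∂ν := by
    have h := (hi.sub hg').norm.aestronglyMeasurable
    rw [← hsnd] at h ⊢
    exact (integral_map measurable_snd.aemeasurable h).symm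
  have hint : Integrable (fun z : E × S => f z.1 * C.indicator 1 z.2) (γ : Measure (E × S)) :=
    integrable_fst_mul_indicator_snd (hfst ▸ hf) hC
  have hF : Integrable F (γ : Measure (E × S)) := F.integrable _
  rw [dist_eq_norm, ← integral_sub hint hF]
  calc ‖∫ z, f z.1 * C.indicator 1 z.2 - F z ∂(γ : Measure (E × S))‖
      ≤ ∫ z, (‖f z.1 - f' z.1‖ + ‖f'‖ * ‖C.indicator 1 z.2 - g' z.2‖)
          ∂(γ : Measure (E × S)) := by
        refine norm_integral_le_of_norm_le (hfi.add (hgi.const_mul _)) (ae_of_all _ fun z => ?_)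
        have hsplit : f z.1 * C.indicator 1 z.2 - F z = (f z.1 - f' z.1) * C.indicator 1 z.2 +
            f' z.1 * (C.indicator 1 z.2 - g' z.2) := by
          change _ - f' z.1 * g' z.2 = _
          ring
        have hone : ‖C.indicator (1 : S → ℝ) z.2‖ ≤ 1 := by
          by_cases hz : z.2 ∈ C <;> simp [hz]
        rw [hsplit]
        refine (norm_add_le _ _).trans (add_le_add ?_ ?_)
        · rw [norm_mul]
          exact mul_le_of_le_one_right (norm_nonneg _) hone
        · rw [norm_mul]
          exact mul_le_mul_of_nonneg_right (f'.norm_coe_le_norm _) (norm_nonneg _)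
    _ = ∫ x, ‖f x - f' x‖ ∂η + ‖f'‖ * ∫ y, ‖C.indicator 1 y - g' y‖ ∂ν := by
        rw [integral_add hfi (hgi.const_mul _), integral_const_mul, hfeq, hgeq]
    _ ≤ ε / 2 / 2 + ‖f'‖ * (ε / 2 / (‖f'‖ + 1)) := by gcongr
    _ < ε := by
        have : ‖f'‖ * (ε / 2 / (‖f'‖ + 1)) ≤ ε / 2 := by
          rw [mul_div_assoc', div_le_iff₀ hM]
          nlinarith [norm_nonneg f']
        linarith

lemma causalPlan_prod {E S : Type*} [MeasurableSpace E] [MeasurableSpace S]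
    (ℱE : unitInterval → MeasurableSpace E) (ℱS : unitInterval → MeasurableSpace S)
    (η : Measure E) [SFinite η] (ν : Measure S) [IsProbabilityMeasure ν] :
    CausalPlan ℱE ℱS η (η.prod ν) := by
  refine ⟨Measure.fst_prod, Kernel.const E ν, ⟨inferInstance, fun A B _ _ => ?_⟩,
    fun t C _ => ?_⟩
  · simp [Measure.prod_prod, mul_comm]
  · simp only [Kernel.const_apply]
    exact measurable_const

lemma CausalPlan.convex_combination {E S : Type*} [MeasurableSpace E] [MeasurableSpace S]
    [StandardBorelSpace S] {ℱE : unitInterval → MeasurableSpace E}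
    {ℱS : unitInterval → MeasurableSpace S} (hleE : ∀ t, ℱE t ≤ ‹MeasurableSpace E›)
    (hleS : ∀ t, ℱS t ≤ ‹MeasurableSpace S›) {η : Measure E} [IsFiniteMeasure η]
    {γ₁ γ₂ : Measure (E × S)} [IsProbabilityMeasure γ₁] [IsProbabilityMeasure γ₂]
    (h₁ : CausalPlan ℱE ℱS η γ₁) (h₂ : CausalPlan ℱE ℱS η γ₂) {a b : ℝ≥0∞} (hab : a + b = 1) :
    CausalPlan ℱE ℱS η (a • γ₁ + b • γ₂) := by
  have : IsProbabilityMeasure (a • γ₁ + b • γ₂) := ⟨by simp [hab]⟩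
  have ha : a ≠ ∞ := fun h => by simp [h] at hab
  have hb : b ≠ ∞ := fun h => by simp [h] at hab
  rw [causalPlan_iff hleE hleS] at h₁ h₂ ⊢
  obtain ⟨hfst₁, h₁⟩ := h₁
  obtain ⟨hfst₂, h₂⟩ := h₂
  refine ⟨?_, fun t C hC A hA => ?_⟩
  · rw [Measure.fst_add, Measure.fst, Measure.fst, Measure.map_smul, Measure.map_smul]
    change a • γ₁.fst + b • γ₂.fst = η
    rw [hfst₁, hfst₂, ← add_smul, hab, one_smul]
  · have hi := integrable_indicatorResidual (ℱE t) η hA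
    have hC' := hleS t C hC
    rw [integral_add_measure
      ((integrable_fst_mul_indicator_snd (hfst₁ ▸ hi) hC').smul_measure ha)
      ((integrable_fst_mul_indicator_snd (hfst₂ ▸ hi) hC').smul_measure hb),
      integral_smul_measure, integral_smul_measure, h₁ t C hC A hA, h₂ t C hC A hA]
    simp

lemma isCompact_causalPlan {E S : Type*} [MeasurableSpace E] [TopologicalSpace E]
    [PolishSpace E] [BorelSpace E] [MeasurableSpace S] [TopologicalSpace S] [PolishSpace S]
    [BorelSpace S] {ℱE : unitInterval → MeasurableSpace E}
    {ℱS : unitInterval → MeasurableSpace S} (hleE : ∀ t, ℱE t ≤ ‹MeasurableSpace E›)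
    (hleS : ∀ t, ℱS t ≤ ‹MeasurableSpace S›) (η : Measure E) [IsProbabilityMeasure η]
    (ν : Measure S) [IsProbabilityMeasure ν] :
    IsCompact {γ : ProbabilityMeasure (E × S) |
      CausalPlan ℱE ℱS η (γ : Measure (E × S)) ∧ (γ : Measure (E × S)).snd = ν} := by
  have heq : {γ : ProbabilityMeasure (E × S) |
      CausalPlan ℱE ℱS η (γ : Measure (E × S)) ∧ (γ : Measure (E × S)).snd = ν} =
      couplings η ν ∩ ⋂ (t) (C) (_ : MeasurableSet[ℱS t] C) (A) (_ : MeasurableSet A),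
        couplings η ν ∩ (fun γ : ProbabilityMeasure (E × S) =>
          ∫ z, indicatorResidual (ℱE t) η A z.1 * C.indicator 1 z.2 ∂(γ : Measure (E × S))) ⁻¹'
            {0} := by
    ext γ
    simp only [mem_ofPred_eq, causalPlan_iff hleE hleS, couplings, mem_inter_iff, mem_iInter,
      mem_preimage, mem_singleton_iff]
    exact ⟨fun h => ⟨⟨h.1.1, h.2⟩, fun t C hC A hA => ⟨⟨h.1.1, h.2⟩, h.1.2 t C hC A hA⟩⟩,
      fun h => ⟨⟨h.1.1, fun t C hC A hA => (h.2 t C hC A hA).2⟩, h.1.2⟩⟩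
  rw [heq]
  refine (isCompact_couplings η ν).inter_right ?_
  refine isClosed_iInter fun t => isClosed_iInter fun C => isClosed_iInter fun hC =>
    isClosed_iInter fun A => isClosed_iInter fun hA => ?_
  exact (continuousOn_integral_fst_mul_indicator_snd (integrable_indicatorResidual _ η hA)
    (hleS t C hC)).preimage_isClosed_of_isClosed (isClosed_couplings η ν) isClosed_singleton

/-- `Π_c(η,ν)` is nonempty (it contains `η ⊗ ν`), convex, and compact in
`P(E × S)` for the topology of weak convergence of probability measures. -/
theorem causal_couplings_nonempty_convex_compact
    {E S : Type*} [MeasurableSpace E] [TopologicalSpace E] [PolishSpace E] [BorelSpace E]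
    [MeasurableSpace S] [TopologicalSpace S] [PolishSpace S] [BorelSpace S]
    (ℱE : unitInterval → MeasurableSpace E) (ℱS : unitInterval → MeasurableSpace S)
    (hmonoE : Monotone ℱE) (hleE : ∀ t, ℱE t ≤ ‹MeasurableSpace E›)
    (hmonoS : Monotone ℱS) (hleS : ∀ t, ℱS t ≤ ‹MeasurableSpace S›)
    (η : Measure E) [IsProbabilityMeasure η] (ν : Measure S) [IsProbabilityMeasure ν] :
    ((⟨η.prod ν, inferInstance⟩ : ProbabilityMeasure (E × S)) ∈
      {γ : ProbabilityMeasure (E × S) |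
        CausalPlan ℱE ℱS η (γ : Measure (E × S)) ∧ (γ : Measure (E × S)).snd = ν}) ∧
    (∀ γ₁ γ₂ : ProbabilityMeasure (E × S),
      γ₁ ∈ {γ : ProbabilityMeasure (E × S) |
        CausalPlan ℱE ℱS η (γ : Measure (E × S)) ∧ (γ : Measure (E × S)).snd = ν} →
      γ₂ ∈ {γ : ProbabilityMeasure (E × S) |
        CausalPlan ℱE ℱS η (γ : Measure (E × S)) ∧ (γ : Measure (E × S)).snd = ν} →
      ∀ a b : ℝ≥0∞, a + b = 1 →
        ∀ γ₃ : ProbabilityMeasure (E × S),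
          (γ₃ : Measure (E × S)) = a • (γ₁ : Measure (E × S)) + b • (γ₂ : Measure (E × S)) →
          γ₃ ∈ {γ : ProbabilityMeasure (E × S) |
            CausalPlan ℱE ℱS η (γ : Measure (E × S)) ∧ (γ : Measure (E × S)).snd = ν}) ∧
    IsCompact {γ : ProbabilityMeasure (E × S) |
      CausalPlan ℱE ℱS η (γ : Measure (E × S)) ∧ (γ : Measure (E × S)).snd = ν} := by
  refine ⟨⟨causalPlan_prod ℱE ℱS η ν, Measure.snd_prod⟩, ?_, isCompact_causalPlan hleE hleS η ν⟩
  rintro γ₁ γ₂ ⟨h₁, hsnd₁⟩ ⟨h₂, hsnd₂⟩ a b hab γ₃ hγ₃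
  refine ⟨hγ₃ ▸ h₁.convex_combination hleE hleS h₂ hab, ?_⟩
  rw [hγ₃, Measure.snd_add, Measure.snd, Measure.snd, Measure.map_smul, Measure.map_smul]
  change a • (γ₁ : Measure (E × S)).snd + b • (γ₂ : Measure (E × S)).snd = ν
  rw [hsnd₁, hsnd₂, ← add_smul, hab, one_smul]
end
end

section
/- Let μ be the Wiener measure on W = C([0,1],ℝ^d) and ν a probability on W absolutely continuous with respect to μ, with Girsanov shift V (the unique ν-a.s. defined map with V − I_W ∈ H ν-a.s. and t ↦ V_t an (F_t^ν)-Brownian motion). Then (I_W × V)_*ν is a causal transference plan from ν to μ, and (V × I_W)_*ν is a causal transference plan from μ to ν. Moreover, for any measurable X : Ω → W on a complete space (Ω,A,P) with X_*P = ν, the process V ∘ X is a Brownian motion with respect to the augmented filtration generated by X. -/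
open MeasureTheory ProbabilityTheory Filter Set Topology
open scoped ENNReal NNReal

noncomputable section

/-- The classical Wiener path space `W = C([0,1], ℝ^d)`. -/
abbrev WW (d : ℕ) := C(unitInterval, EuclideanSpace ℝ (Fin d))

instance (d : ℕ) : MeasurableSpace (WW d) := borel _
instance (d : ℕ) : BorelSpace (WW d) := ⟨rfl⟩

/-- The filtration generated by the coordinate process on `W`. -/
def coordF (d : ℕ) (t : unitInterval) : MeasurableSpace (WW d) :=
  ⨆ (s : unitInterval) (_ : s ≤ t),
    MeasurableSpace.comap (fun ω : WW d => ω s) inferInstance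

/-- `Y : Ω → W` is a `d`-dimensional Brownian motion with respect to the filtration `𝒜`
under `P`: it is `𝒜`-adapted, starts at `0`, and has increments which are Gaussian with
variance `t - s` and independent of `𝒜 s`. -/
def IsBMWrt {d : ℕ} {Ω : Type*} [MeasurableSpace Ω]
    (𝒜 : unitInterval → MeasurableSpace Ω) (Y : Ω → WW d) (P : Measure Ω) : Prop :=
  (∀ t : unitInterval, Measurable[𝒜 t] (fun ω => Y ω t)) ∧
  (∀ᵐ ω ∂P, Y ω 0 = 0) ∧
  (∀ s t : unitInterval, s ≤ t →
    (∀ i : Fin d,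
      P.map (fun ω => Y ω t i - Y ω s i) = gaussianReal 0 (Real.toNNReal ((t : ℝ) - s))) ∧
    Indep (MeasurableSpace.comap (fun ω => Y ω t - Y ω s) inferInstance) (𝒜 s) P)

/-- `μ` is the Wiener measure on `W`. -/
def IsWienerMeasure {d : ℕ} (μ : Measure (WW d)) : Prop :=
  IsProbabilityMeasure μ ∧ IsBMWrt (coordF d) (fun ω => ω) μ

/-- The square of the Cameron–Martin norm of a path, extended by `∞` off `H`:
`|h|_H² = sup` over partitions of `Σ ‖h(t_{k+1}) - h(t_k)‖² / (t_{k+1} - t_k)`. -/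
def cmNormSq {d : ℕ} (h : WW d) : ℝ≥0∞ :=
  ⨆ (n : ℕ) (τ : Fin (n + 1) → unitInterval) (_ : Monotone τ),
    ∑ k : Fin n, ENNReal.ofReal
      (‖h (τ k.succ) - h (τ k.castSucc)‖ ^ 2 / ((τ k.succ : ℝ) - (τ k.castSucc : ℝ)))

/-- The Girsanov shift of a probability `ν ≪ μ`: the ν-a.s. unique map `V` with
`V - I_W ∈ H` ν-a.s. such that `t ↦ V_t` is an `(F_t^ν)`-Brownian motion. -/
def IsGirsanovShift {d : ℕ} (ν : Measure (WW d)) (V : WW d → WW d) : Prop :=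
  Measurable V ∧ (∀ᵐ ω ∂ν, cmNormSq (V ω - ω) ≠ ⊤) ∧
    IsBMWrt (fun t => aug ν (coordF d t)) V ν

/-- The relative entropy `H(ν|μ) = E_ν[ln dν/dμ]`. -/
def relEnt {d : ℕ} (ν μ : Measure (WW d)) : ℝ :=
  ∫ ω, Real.log ((ν.rnDeriv μ ω).toReal) ∂ν

section Sigma

variable {d : ℕ}

lemma measurable_path_eval (t : unitInterval) : Measurable (fun ω : WW d => ω t) :=
  (continuous_eval_const t).measurable

lemma coordF_le (t : unitInterval) : coordF d t ≤ (inferInstance : MeasurableSpace (WW d)) :=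
  iSup₂_le fun s _ => (measurable_path_eval s).comap_le

lemma coordF_mono : Monotone (coordF d) := fun _ _ hst =>
  iSup₂_le fun u hu => le_iSup₂_of_le u (hu.trans hst) le_rfl

lemma measurable_coordF_eval {s t : unitInterval} (hst : s ≤ t) :
    Measurable[coordF d t] (fun ω : WW d => ω s) :=
  measurable_iff_comap_le.2 (le_iSup₂_of_le s hst le_rfl)

lemma coordF_one : coordF d 1 = (inferInstance : MeasurableSpace (WW d)) := by
  refine le_antisymm (coordF_le 1) ?_
  obtain ⟨D, hDc, hD⟩ := TopologicalSpace.exists_countable_dense unitInterval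
  have := hDc.to_subtype
  let r : WW d → (D → EuclideanSpace ℝ (Fin d)) := fun ω q => ω q
  have hr : Continuous r :=
    continuous_pi fun q => continuous_eval_const (q : unitInterval)
  have hinj : Function.Injective r := by
    intro f g hfg
    refine DFunLike.coe_injective
      (Continuous.ext_on hD f.continuous g.continuous fun q hq => congrFun hfg ⟨q, hq⟩)
  rw [← (hr.measurableEmbedding hinj).comap_eq]
  refine measurable_iff_comap_le.1 ?_
  exact @measurable_pi_lambda _ _ _ (coordF d 1) _ _ fun q => measurable_coordF_eval q.1.2.2

lemma measurable_coordF_iff {α : Type*} {m : MeasurableSpace α} {f : α → WW d}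
    {t : unitInterval} :
    Measurable[m, coordF d t] f ↔ ∀ s ≤ t, Measurable[m] (fun a => f a s) := by
  rw [measurable_iff_comap_le, coordF]
  simp only [MeasurableSpace.comap_iSup, iSup_le_iff, MeasurableSpace.comap_comp,
    measurable_iff_comap_le, Function.comp_def]

lemma measurable_path_iff {α : Type*} {m : MeasurableSpace α} {f : α → WW d} :
    Measurable f ↔ ∀ s, Measurable (fun a => f a s) := by
  have h := measurable_coordF_iff (m := m) (f := f) (t := 1)
  rw [coordF_one] at h
  exact h.trans ⟨fun h s => h s s.2.2, fun h s _ => h s⟩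

end Sigma

section Augmentation

variable {α : Type*} {m : MeasurableSpace α} [mα : MeasurableSpace α] {η : Measure α}

lemma measurableSet_aug_iff {s : Set α} :
    MeasurableSet[aug η m] s ↔ ∃ s', MeasurableSet[m] s' ∧ s =ᵐ[η] s' := by
  constructor
  · have hle : aug η m ≤ eventuallyMeasurableSpace m (ae η) := by
      refine sup_le (fun s hs => ⟨s, hs, ae_eq_refl _⟩) (MeasurableSpace.generateFrom_le ?_)
      exact fun s hs => ⟨∅, @MeasurableSet.empty _ m, ae_eq_empty.2 hs⟩
    exact fun hs => hle s hs
  · rintro ⟨s', hs', h⟩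
    rw [ae_eq_set] at h
    have hm : MeasurableSet[aug η m] s' := (le_sup_left : m ≤ aug η m) _ hs'
    have hnull : ∀ u, η u = 0 → MeasurableSet[aug η m] u := fun u hu =>
      (le_sup_right : _ ≤ aug η m) _ (MeasurableSpace.measurableSet_generateFrom hu)
    have : s = (s' \ (s' \ s)) ∪ (s \ s') := by
      ext x; by_cases h1 : x ∈ s <;> by_cases h2 : x ∈ s' <;> simp [h1, h2]
    rw [this]
    exact MeasurableSet.union (MeasurableSet.diff hm (hnull _ h.2)) (hnull _ h.1)

lemma le_aug : m ≤ aug η m := le_sup_left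

lemma aug_mono {α : Type*} {m n : MeasurableSpace α} [MeasurableSpace α] {η : Measure α}
    (h : n ≤ m) : aug η n ≤ aug η m :=
  sup_le_sup_right h _

lemma Measurable.aug_of_ae_eq {β : Type*} [MeasurableSpace β] {f g : α → β}
    (hg : Measurable[m] g) (hfg : f =ᵐ[η] g) : Measurable[aug η m] f := by
  intro B hB
  refine measurableSet_aug_iff.2 ⟨g ⁻¹' B, hg hB, ?_⟩
  filter_upwards [hfg] with x hx
  exact congrArg (· ∈ B) hx

lemma measurableSet_aug_preimage {Ω : Type*} [MeasurableSpace Ω] {P : Measure Ω} {X : Ω → α}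
    (hX : Measurable X) {s : Set α} (hs : MeasurableSet[aug (P.map X) m] s) :
    MeasurableSet[aug P (m.comap X)] (X ⁻¹' s) := by
  obtain ⟨s', hs', h⟩ := measurableSet_aug_iff.1 hs
  exact measurableSet_aug_iff.2
    ⟨X ⁻¹' s', ⟨s', hs', rfl⟩, (hX.quasiMeasurePreserving P).preimage_ae_eq h⟩

end Augmentation

section IndependentIncrements

variable {d : ℕ}

/-- A law on the path space has independent increments for the coordinate filtration. -/
def HasIndepCoordIncrements (P : Measure (WW d)) : Prop :=
  ∀ s t : unitInterval, s ≤ t →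
    Indep (MeasurableSpace.comap (fun ω : WW d => ω t - ω s) inferInstance) (coordF d s) P

lemma HasIndepCoordIncrements.indepFun {P : Measure (WW d)} (hP : HasIndepCoordIncrements P)
    {s t : unitInterval} (hst : s ≤ t) {β γ : Type*} [MeasurableSpace β] [MeasurableSpace γ]
    {f : WW d → β} (hf : Measurable[coordF d s] f)
    {g : EuclideanSpace ℝ (Fin d) → γ} (hg : Measurable g) :
    IndepFun f (fun ω => g (ω t - ω s)) P := by
  rw [IndepFun_iff_Indep]
  refine indep_of_indep_of_le_left (indep_of_indep_of_le_right (hP s t hst).symm ?_) ?_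
  · rw [← measurable_iff_comap_le]
    exact hg.comp (comap_measurable _)
  · exact measurable_iff_comap_le.1 hf

/-- The path observed at the times in `J` and set to `0` at all other times. -/
def observe (J : Finset unitInterval) (ω : WW d) : unitInterval → EuclideanSpace ℝ (Fin d) :=
  fun u => if u ∈ J then ω u else 0

lemma measurable_observe {J : Finset unitInterval} {t : unitInterval} (hJ : ∀ s ∈ J, s ≤ t) :
    Measurable[coordF d t] (observe (d := d) J) := by
  refine @measurable_pi_lambda _ _ _ (coordF d t) _ _ fun u => ?_
  by_cases hu : u ∈ J
  · simpa [observe, hu] using measurable_coordF_eval (d := d) (hJ u hu)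
  · simp [observe, hu]

lemma map_observe_eq {P P' : Measure (WW d)} [IsProbabilityMeasure P] [IsProbabilityMeasure P']
    (h0 : ∀ᵐ ω ∂P, ω 0 = 0) (h0' : ∀ᵐ ω ∂P', ω 0 = 0)
    (hP : HasIndepCoordIncrements P) (hP' : HasIndepCoordIncrements P')
    (heq : ∀ s t : unitInterval, s ≤ t →
      P.map (fun ω => ω t - ω s) = P'.map (fun ω => ω t - ω s)) (J : Finset unitInterval) :
    P.map (observe J) = P'.map (observe J) := by
  induction J using Finset.induction_on_max with
  | empty =>
    have : observe (d := d) ∅ = fun _ => 0 := by ext; simp [observe]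
    rw [this, Measure.map_const, Measure.map_const]; simp
  | insert a J hJ ih =>
    obtain ⟨m, hma, hJm, hm⟩ : ∃ m, m ≤ a ∧ (∀ s ∈ J, s ≤ m) ∧ (m ∈ J ∨ m = 0) := by
      rcases J.eq_empty_or_nonempty with rfl | hne
      · exact ⟨0, a.2.1, by simp, Or.inr rfl⟩
      · exact ⟨J.max' hne, (hJ _ (J.max'_mem hne)).le, fun s hs => J.le_max' s hs,
          Or.inl (J.max'_mem hne)⟩
    let F : (unitInterval → EuclideanSpace ℝ (Fin d)) × EuclideanSpace ℝ (Fin d) →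
        (unitInterval → EuclideanSpace ℝ (Fin d)) :=
      fun p u => if u = a then p.1 m + p.2 else p.1 u
    have hF : Measurable F := by
      refine measurable_pi_lambda _ fun u => ?_
      by_cases hu : u = a
      · simp only [F, hu, if_true]; fun_prop
      · simp only [F, hu, if_false]; fun_prop
    have hobs : Measurable (observe (d := d) J) :=
      (measurable_observe hJm).mono (coordF_le m) le_rfl
    have hincr : Measurable (fun ω : WW d => ω a - ω m) :=
      (measurable_path_eval a).sub (measurable_path_eval m)
    have key : ∀ Q : Measure (WW d), IsProbabilityMeasure Q → (∀ᵐ ω ∂Q, ω 0 = 0) →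
        HasIndepCoordIncrements Q → Q.map (observe (insert a J)) =
          ((Q.map (observe J)).prod (Q.map (fun ω => ω a - ω m))).map F := by
      intro Q _ hQ0 hQ
      have hind : IndepFun (observe J) (fun ω => ω a - ω m) Q :=
        hQ.indepFun hma (measurable_observe hJm) measurable_id
      rw [← (indepFun_iff_map_prod_eq_prod_map_map hobs.aemeasurable hincr.aemeasurable).1 hind,
        Measure.map_map hF (hobs.prodMk hincr)]
      refine Measure.map_congr ?_
      filter_upwards [hQ0] with ω hω
      ext1 u
      by_cases hu : u = a
      · have : observe J ω m = ω m := by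
          rcases hm with hm | hm
          · simp [observe, hm]
          · simp [observe, hm, hω]
        simp [F, hu, this]
        simp [observe]
      · simp [F, hu, observe]
    rw [key P ‹_› h0 hP, key P' ‹_› h0' hP', ih, heq m a hma]

/-- A law on the path space of a process started at `0` with independent increments is determined
by the laws of its increments. -/
lemma eq_of_map_increments_eq {P P' : Measure (WW d)} [IsProbabilityMeasure P]
    [IsProbabilityMeasure P'] (h0 : ∀ᵐ ω ∂P, ω 0 = 0) (h0' : ∀ᵐ ω ∂P', ω 0 = 0)
    (hP : HasIndepCoordIncrements P) (hP' : HasIndepCoordIncrements P')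
    (heq : ∀ s t : unitInterval, s ≤ t →
      P.map (fun ω => ω t - ω s) = P'.map (fun ω => ω t - ω s)) :
    P = P' := by
  let e : WW d → (unitInterval → EuclideanSpace ℝ (Fin d)) := fun ω u => ω u
  have hgen : (inferInstance : MeasurableSpace (WW d)) = MeasurableSpace.generateFrom
      (preimage e '' squareCylinders fun _ =>
        {s : Set (EuclideanSpace ℝ (Fin d)) | MeasurableSet s}) := by
    rw [← MeasurableSpace.comap_generateFrom, generateFrom_squareCylinders]
    refine le_antisymm ?_ ?_
    · rw [← coordF_one]
      refine iSup₂_le fun s _ => measurable_iff_comap_le.1 ?_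
      exact (measurable_pi_apply s).comp (comap_measurable e)
    · exact (measurable_pi_lambda e fun u => measurable_path_eval u).comap_le
  refine ext_of_generate_finite _ hgen
    ((isPiSystem_squareCylinders (fun _ => MeasurableSpace.isPiSystem_measurableSet)
      fun _ => MeasurableSet.univ).comap e) ?_ (by simp)
  rintro _ ⟨_, ⟨J, B, hB, rfl⟩, rfl⟩
  have hpre : e ⁻¹' (J : Set unitInterval).pi B = observe J ⁻¹' (J : Set unitInterval).pi B := by
    ext ω
    simp only [mem_preimage, Set.mem_pi]
    exact forall₂_congr fun u hu => by simp [e, observe, Finset.mem_coe.1 hu]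
  have hmeas : MeasurableSet ((J : Set unitInterval).pi B) :=
    MeasurableSet.pi J.countable_toSet fun u _ => hB u (mem_univ u)
  have hobs : Measurable (observe (d := d) J) :=
    (measurable_observe fun u _ => u.2.2).mono (coordF_le 1) le_rfl
  rw [hpre, ← Measure.map_apply hobs hmeas, ← Measure.map_apply hobs hmeas,
    map_observe_eq h0 h0' hP hP' heq J]

end IndependentIncrements

section FutureIncrements

variable {d : ℕ}

lemma IsBMWrt.isWienerMeasure_map {Ω : Type*} [MeasurableSpace Ω] {P : Measure Ω}
    [IsProbabilityMeasure P] {𝒜 : unitInterval → MeasurableSpace Ω} (h𝒜 : Monotone 𝒜)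
    {Y : Ω → WW d} (hY : Measurable Y) (h : IsBMWrt 𝒜 Y P) : IsWienerMeasure (P.map Y) := by
  refine ⟨Measure.isProbabilityMeasure_map hY.aemeasurable,
    fun t => measurable_coordF_eval le_rfl, ?_, fun s t hst => ⟨fun i => ?_, ?_⟩⟩
  · refine (ae_map_iff hY.aemeasurable ?_).2 h.2.1
    exact measurableSet_eq_fun (measurable_path_eval 0) measurable_const
  · rw [← (h.2.2 s t hst).1 i, Measure.map_map _ hY]
    · rfl
    · have := measurable_path_eval (d := d) s
      have := measurable_path_eval (d := d) t
      fun_prop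
  · rw [Indep_iff]
    rintro _ C ⟨B, hB, rfl⟩ hC
    have hincr : Measurable (fun ω : WW d => ω t - ω s) :=
      (measurable_path_eval t).sub (measurable_path_eval s)
    have hC' := coordF_le s _ hC
    have hpast : MeasurableSet[𝒜 s] (Y ⁻¹' C) :=
      measurable_coordF_iff.2 (fun u hu => (h.1 u).mono (h𝒜 hu) le_rfl) hC
    rw [Measure.map_apply hY ((hincr hB).inter hC'), Measure.map_apply hY (hincr hB),
      Measure.map_apply hY hC']
    exact (Indep_iff _ _ _).1 (h.2.2 s t hst).2 _ _ ⟨B, hB, rfl⟩ hpast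

lemma IsWienerMeasure.hasIndepCoordIncrements {P : Measure (WW d)} (hP : IsWienerMeasure P) :
    HasIndepCoordIncrements P := fun s t hst => (hP.2.2.2 s t hst).2

/-- The increments of a path after time `t`. -/
def futureShift (t : unitInterval) (ω : WW d) : WW d :=
  ⟨fun u => ω (u ⊔ t) - ω t, by fun_prop⟩

lemma measurable_futureShift (t : unitInterval) : Measurable (futureShift (d := d) t) :=
  measurable_path_iff.2 fun u => (measurable_path_eval (u ⊔ t)).sub (measurable_path_eval t)

lemma futureShift_sub (t s u : unitInterval) (ω : WW d) :
    futureShift t ω u - futureShift t ω s = ω (u ⊔ t) - ω (s ⊔ t) :=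
  sub_sub_sub_cancel_right _ _ _

/-- The increments of a Brownian motion after time `t` are jointly independent of the past. -/
lemma IsBMWrt.indep_futureShift {Ω : Type*} [mΩ : MeasurableSpace Ω] {P : Measure Ω}
    [IsProbabilityMeasure P] {𝒜 : unitInterval → MeasurableSpace Ω} (h𝒜 : Monotone 𝒜)
    (hle : ∀ t, 𝒜 t ≤ mΩ) {Y : Ω → WW d} (hY : Measurable Y) (h : IsBMWrt 𝒜 Y P)
    (t : unitInterval) :
    Indep (MeasurableSpace.comap (fun ω => futureShift t (Y ω)) inferInstance) (𝒜 t) P := by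
  let D : Ω → WW d := fun ω => futureShift t (Y ω)
  have hD : Measurable D := (measurable_futureShift t).comp hY
  have hincr : ∀ s u, Measurable (fun ω : WW d => ω u - ω s) := fun s u =>
    (measurable_path_eval u).sub (measurable_path_eval s)
  have hpast : ∀ s C, MeasurableSet[coordF d s] C → MeasurableSet[𝒜 (s ⊔ t)] (D ⁻¹' C) := by
    refine fun s C hC => measurable_coordF_iff.2 (fun u hu => ?_) hC
    exact Measurable.sub ((h.1 (u ⊔ t)).mono (h𝒜 (sup_le_sup_right hu t)) le_rfl)
      ((h.1 t).mono (h𝒜 le_sup_right) le_rfl)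
  have hmul : ∀ s u, s ≤ u → ∀ B, MeasurableSet B → ∀ A, MeasurableSet[𝒜 (s ⊔ t)] A →
      P (A ∩ D ⁻¹' ((fun ω : WW d => ω u - ω s) ⁻¹' B)) =
        P A * P (D ⁻¹' ((fun ω : WW d => ω u - ω s) ⁻¹' B)) := by
    intro s u hsu B hB A hA
    rw [inter_comm, mul_comm]
    refine (Indep_iff _ _ _).1 (h.2.2 (s ⊔ t) (u ⊔ t) (sup_le_sup_right hsu t)).2 _ _ ⟨B, hB, ?_⟩ hA
    ext ω
    simp only [D, mem_preimage, futureShift_sub]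
  have hcond : ∀ A, MeasurableSet[𝒜 t] A → P A ≠ 0 →
      (∀ᵐ ω ∂(P[|A]).map D, ω 0 = 0) ∧ HasIndepCoordIncrements ((P[|A]).map D) ∧
      ∀ s u, s ≤ u → ((P[|A]).map D).map (fun ω => ω u - ω s) =
        (P.map D).map (fun ω => ω u - ω s) := by
    intro A hA hA0
    have hA' := hle t _ hA
    have hval : ∀ s u, s ≤ u → ∀ B, MeasurableSet B →
        (P[|A]) (D ⁻¹' ((fun ω : WW d => ω u - ω s) ⁻¹' B)) =
          P (D ⁻¹' ((fun ω : WW d => ω u - ω s) ⁻¹' B)) := by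
      intro s u hsu B hB
      rw [cond_apply hA', hmul s u hsu B hB A (h𝒜 le_sup_right _ hA), ← mul_assoc,
        ENNReal.inv_mul_cancel hA0 (measure_ne_top _ _), one_mul]
    refine ⟨?_, fun s u hsu => ?_, fun s u hsu => ?_⟩
    · refine (ae_map_iff hD.aemeasurable
        (measurableSet_eq_fun (measurable_path_eval 0) measurable_const)).2 (ae_of_all _ ?_)
      intro ω
      simp [D, futureShift]
    · rw [Indep_iff]
      rintro _ C ⟨B, hB, rfl⟩ hC
      have hC' := coordF_le s _ hC
      rw [Measure.map_apply hD ((hincr s u hB).inter hC'), Measure.map_apply hD (hincr s u hB),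
        Measure.map_apply hD hC', hval s u hsu B hB, cond_apply hA', cond_apply hA', preimage_inter,
        inter_comm (D ⁻¹' _) (D ⁻¹' C), ← inter_assoc,
        hmul s u hsu B hB _ ((h𝒜 le_sup_right _ hA).inter (hpast s C hC))]
      ring
    · ext B hB
      rw [Measure.map_apply (hincr s u) hB, Measure.map_apply (hincr s u) hB,
        Measure.map_apply hD (hincr s u hB), Measure.map_apply hD (hincr s u hB),
        hval s u hsu B hB]
  rw [Indep_iff]
  rintro _ A ⟨B, hB, rfl⟩ hA
  by_cases hA0 : P A = 0
  · rw [hA0, mul_zero]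
    exact measure_mono_null inter_subset_right hA0
  have := cond_isProbabilityMeasure hA0
  have := Measure.isProbabilityMeasure_map (μ := P) hD.aemeasurable
  have := Measure.isProbabilityMeasure_map (μ := P[|A]) hD.aemeasurable
  obtain ⟨h1, h2, h3⟩ := hcond A hA hA0
  obtain ⟨h1', h2', -⟩ := hcond univ MeasurableSet.univ (by simp)
  rw [cond_univ] at h1' h2'
  have heq := congrArg (fun Q => Q B) (eq_of_map_increments_eq h1 h1' h2 h2' h3)
  simp only [Measure.map_apply hD hB, cond_apply (hle t _ hA)] at heq
  change P (D ⁻¹' B ∩ A) = P (D ⁻¹' B) * P A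
  rw [← heq, inter_comm, mul_comm, ← mul_assoc, ENNReal.mul_inv_cancel hA0 (measure_ne_top _ _),
    one_mul]

end FutureIncrements

section Moments

variable {d : ℕ}

lemma norm_exp_mul_I_sub_taylor_le (x : ℝ) :
    ‖Complex.exp (x * Complex.I) - (1 + x * Complex.I - x ^ 2 / 2)‖ ≤ 4 * |x| ^ 3 := by
  have hnorm : ‖(x * Complex.I : ℂ)‖ = |x| := by simp
  rcases le_total |x| 1 with hx | hx
  · have h := Complex.exp_bound (x := x * Complex.I) (by rwa [hnorm]) (n := 3) (by norm_num)
    have hsum : ∑ m ∈ Finset.range 3, (x * Complex.I : ℂ) ^ m / (m.factorial : ℂ) =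
        1 + x * Complex.I - x ^ 2 / 2 := by
      simp [Finset.sum_range_succ, Nat.factorial, mul_pow]
      ring
    rw [hsum, hnorm] at h
    refine h.trans ?_
    rw [mul_comm]
    gcongr
    norm_num [Nat.factorial]
  · have h1 : ‖Complex.exp (x * Complex.I)‖ = 1 := Complex.norm_exp_ofReal_mul_I x
    have h2 : ‖(1 + x * Complex.I - x ^ 2 / 2 : ℂ)‖ ≤ 1 + |x| + |x| ^ 2 / 2 := by
      refine (norm_sub_le _ _).trans (add_le_add ((norm_add_le _ _).trans ?_) ?_)
      · simp
      · simp
    refine (norm_sub_le _ _).trans ?_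
    rw [h1]
    nlinarith [h2, mul_nonneg (sub_nonneg.2 hx) (sub_nonneg.2 hx), pow_nonneg (abs_nonneg x) 2,
      mul_nonneg (pow_nonneg (abs_nonneg x) 2) (sub_nonneg.2 hx),
      mul_nonneg (abs_nonneg x) (sub_nonneg.2 hx)]

lemma integral_abs_pow_gaussianReal (p : ℕ) (v : ℝ≥0) :
    ∫ x, |x| ^ p ∂gaussianReal 0 v = √v ^ p * ∫ x, |x| ^ p ∂gaussianReal 0 1 := by
  have h := gaussianReal_map_const_mul (μ := 0) (v := 1) √(v : ℝ)
  have hv : (NNReal.mk (√(v : ℝ) ^ 2) (sq_nonneg _) * 1 : ℝ≥0) = v := by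
    ext; simp
  rw [mul_zero, hv] at h
  rw [← h, integral_map (by fun_prop) (by fun_prop), ← integral_const_mul]
  simp [abs_mul, mul_pow, abs_of_nonneg (Real.sqrt_nonneg _)]

/-- The increment of a path over `[s, t]` in the direction `ξ`. -/
def pathIncr (ξ : EuclideanSpace ℝ (Fin d)) (s t : unitInterval) (ω : WW d) : ℝ :=
  inner ℝ ξ (ω t - ω s)

lemma measurable_pathIncr (ξ : EuclideanSpace ℝ (Fin d)) (s t : unitInterval) :
    Measurable (pathIncr ξ s t) :=
  Measurable.inner measurable_const ((measurable_path_eval t).sub (measurable_path_eval s))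

lemma pathIncr_eq_sum (ξ : EuclideanSpace ℝ (Fin d)) (s t : unitInterval) (ω : WW d) :
    pathIncr ξ s t ω = ∑ i, ξ i * (ω t i - ω s i) := by
  simp [pathIncr, PiLp.inner_apply, mul_comm]

namespace IsWienerMeasure

variable {P : Measure (WW d)}

lemma memLp_coord (hP : IsWienerMeasure P) {s t : unitInterval} (hst : s ≤ t) (i : Fin d)
    (q : ℝ≥0) : MemLp (fun ω : WW d => ω t i - ω s i) q P := by
  have h := memLp_id_gaussianReal (μ := 0) (v := Real.toNNReal ((t : ℝ) - s)) q
  rw [← (hP.2.2.2 s t hst).1 i] at h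
  have := measurable_path_eval (d := d) s
  have := measurable_path_eval (d := d) t
  exact (memLp_map_measure_iff aestronglyMeasurable_id (by fun_prop)).1 h

lemma memLp_pathIncr (hP : IsWienerMeasure P) (ξ : EuclideanSpace ℝ (Fin d))
    {s t : unitInterval} (hst : s ≤ t) (q : ℝ≥0) : MemLp (pathIncr ξ s t) q P := by
  rw [funext (pathIncr_eq_sum ξ s t)]
  exact memLp_finsetSum _ fun i _ => (hP.memLp_coord hst i q).const_mul _

lemma integral_pathIncr (hP : IsWienerMeasure P) (ξ : EuclideanSpace ℝ (Fin d))
    {s t : unitInterval} (hst : s ≤ t) : ∫ ω, pathIncr ξ s t ω ∂P = 0 := by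
  have := hP.1
  have := measurable_path_eval (d := d) s
  have := measurable_path_eval (d := d) t
  simp_rw [pathIncr_eq_sum]
  rw [integral_finsetSum _ fun i _ =>
    ((hP.memLp_coord hst i 1).integrable le_rfl).const_mul _]
  refine Finset.sum_eq_zero fun i _ => ?_
  have h := integral_id_gaussianReal (μ := 0) (v := Real.toNNReal ((t : ℝ) - s))
  rw [← (hP.2.2.2 s t hst).1 i, integral_map (by fun_prop) (by fun_prop)] at h
  rw [integral_const_mul, h, mul_zero]

lemma exists_integral_abs_pow_le (ξ : EuclideanSpace ℝ (Fin d)) {p : ℕ} (hp : p ≠ 0) :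
    ∃ C : ℝ, 0 ≤ C ∧ ∀ P : Measure (WW d), IsWienerMeasure P → ∀ s t : unitInterval, s ≤ t →
      ∫ ω, |pathIncr ξ s t ω| ^ p ∂P ≤ C * √((t : ℝ) - s) ^ p := by
  obtain ⟨p, rfl⟩ := Nat.exists_eq_succ_of_ne_zero hp
  refine ⟨d ^ p * ∑ i, |ξ i| ^ (p + 1) * ∫ x, |x| ^ (p + 1) ∂gaussianReal 0 1, by positivity,
    fun P hP s t hst => ?_⟩
  have := hP.1
  have := measurable_path_eval (d := d) s
  have := measurable_path_eval (d := d) t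
  have hst' : 0 ≤ (t : ℝ) - s := sub_nonneg.2 hst
  have hint : ∀ i, Integrable (fun ω : WW d => |ω t i - ω s i| ^ (p + 1)) P := fun i => by
    simpa using (hP.memLp_coord hst i (p + 1 : ℕ)).integrable_norm_pow (by simp)
  have hmom : ∀ i, ∫ ω, |ω t i - ω s i| ^ (p + 1) ∂P =
      √((t : ℝ) - s) ^ (p + 1) * ∫ x, |x| ^ (p + 1) ∂gaussianReal 0 1 := fun i => by
    have h := integral_abs_pow_gaussianReal (p + 1) (Real.toNNReal ((t : ℝ) - s))
    rw [← (hP.2.2.2 s t hst).1 i, integral_map (by fun_prop) (by fun_prop),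
      Real.coe_toNNReal _ hst'] at h
    exact h
  calc ∫ ω, |pathIncr ξ s t ω| ^ (p + 1) ∂P
      ≤ ∫ ω, d ^ p * ∑ i, |ξ i| ^ (p + 1) * |ω t i - ω s i| ^ (p + 1) ∂P := by
        refine integral_mono ?_ ?_ fun ω => ?_
        · simpa using (hP.memLp_pathIncr ξ hst (p + 1 : ℕ)).integrable_norm_pow (by simp)
        · exact (integrable_finsetSum _ fun i _ => (hint i).const_mul _).const_mul _
        · dsimp only
          rw [pathIncr_eq_sum]
          calc |∑ i, ξ i * (ω t i - ω s i)| ^ (p + 1)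
              ≤ (∑ i, |ξ i * (ω t i - ω s i)|) ^ (p + 1) := by
                gcongr
                exact Finset.abs_sum_le_sum_abs _ _
            _ ≤ (Finset.univ : Finset (Fin d)).card ^ p *
                  ∑ i, |ξ i * (ω t i - ω s i)| ^ (p + 1) :=
                pow_sum_le_card_mul_sum_pow (fun i _ => abs_nonneg _) p
            _ = _ := by simp [abs_mul, mul_pow]
    _ = _ := by
        rw [integral_const_mul, integral_finsetSum _ fun i _ => (hint i).const_mul _]
        simp_rw [integral_const_mul, hmom]
        rw [mul_assoc, Finset.sum_mul]
        congr 2 with i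
        rw [Nat.succ_eq_add_one]
        ring

end IsWienerMeasure

end Moments

section CharacteristicFunction

variable {d : ℕ} {P P' : Measure (WW d)}

lemma charFun_map_increment (P : Measure (WW d)) (ξ : EuclideanSpace ℝ (Fin d))
    (s t : unitInterval) :
    charFun (P.map (fun ω => ω t - ω s)) ξ =
      ∫ ω, Complex.exp (pathIncr ξ s t ω * Complex.I) ∂P := by
  have := measurable_path_eval (d := d) s
  have := measurable_path_eval (d := d) t
  rw [charFun_apply, integral_map (by fun_prop) (by fun_prop)]
  simp_rw [pathIncr, real_inner_comm]

lemma IsWienerMeasure.norm_charFun_sub_le (ξ : EuclideanSpace ℝ (Fin d)) :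
    ∃ C : ℝ, 0 ≤ C ∧ ∀ P : Measure (WW d), IsWienerMeasure P → ∀ s t : unitInterval, s ≤ t →
      ‖charFun (P.map (fun ω => ω t - ω s)) ξ -
        (1 - (∫ ω, pathIncr ξ s t ω ^ 2 ∂P : ℝ) / 2 : ℂ)‖ ≤ C * √((t : ℝ) - s) ^ 3 := by
  obtain ⟨C, hC, h⟩ := IsWienerMeasure.exists_integral_abs_pow_le ξ (p := 3) (by norm_num)
  refine ⟨4 * C, by positivity, fun P hP s t hst => ?_⟩
  have := hP.1
  have hZ := measurable_pathIncr ξ s t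
  have h1 : Integrable (fun ω => (pathIncr ξ s t ω : ℂ)) P :=
    ((hP.memLp_pathIncr ξ hst 1).integrable le_rfl).ofReal
  have h2 : Integrable (fun ω => ((pathIncr ξ s t ω ^ 2 : ℝ) : ℂ)) P :=
    (hP.memLp_pathIncr ξ hst 2).integrable_sq.ofReal
  have h3 : Integrable (fun ω => |pathIncr ξ s t ω| ^ 3) P := by
    simpa using (hP.memLp_pathIncr ξ hst (3 : ℕ)).integrable_norm_pow (by simp)
  have hexp : Integrable (fun ω => Complex.exp (pathIncr ξ s t ω * Complex.I)) P := by
    refine Integrable.of_bound (by fun_prop) 1 (ae_of_all _ fun ω => ?_)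
    rw [Complex.norm_exp_ofReal_mul_I]
  have h1' : ∫ ω, (pathIncr ξ s t ω : ℂ) ∂P = 0 := by
    have : ∫ ω, (pathIncr ξ s t ω : ℂ) ∂P = (∫ ω, pathIncr ξ s t ω ∂P : ℝ) := integral_ofReal
    rw [this, hP.integral_pathIncr ξ hst, Complex.ofReal_zero]
  have h2' : ∫ ω, ((pathIncr ξ s t ω ^ 2 : ℝ) : ℂ) ∂P =
    (∫ ω, pathIncr ξ s t ω ^ 2 ∂P : ℝ) := integral_ofReal
  have hA : Integrable (fun ω => (1 : ℂ) + pathIncr ξ s t ω * Complex.I) P :=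
    (integrable_const _).add (h1.mul_const _)
  have hB : Integrable (fun ω => ((pathIncr ξ s t ω ^ 2 : ℝ) : ℂ) / 2) P := h2.div_const _
  have hAB : Integrable (fun ω => (1 : ℂ) + pathIncr ξ s t ω * Complex.I -
      ((pathIncr ξ s t ω ^ 2 : ℝ) : ℂ) / 2) P := hA.sub hB
  have hpoly : ∫ ω, ((1 : ℂ) + pathIncr ξ s t ω * Complex.I -
      ((pathIncr ξ s t ω ^ 2 : ℝ) : ℂ) / 2) ∂P =
      1 - (∫ ω, pathIncr ξ s t ω ^ 2 ∂P : ℝ) / 2 := by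
    rw [integral_sub hA hB, integral_add (integrable_const _) (h1.mul_const _),
      integral_mul_const, integral_div, h1', h2']
    simp
  rw [charFun_map_increment, ← hpoly, ← integral_sub hexp hAB, mul_assoc]
  refine (norm_integral_le_integral_norm _).trans ?_
  refine le_trans ?_ (mul_le_mul_of_nonneg_left (h P hP s t hst) (by norm_num : (0 : ℝ) ≤ 4))
  rw [← integral_const_mul]
  refine integral_mono (hexp.sub hAB).norm (h3.const_mul _) fun ω => ?_
  simpa using norm_exp_mul_I_sub_taylor_le (pathIncr ξ s t ω)

lemma HasIndepCoordIncrements.charFun_eq_mul [IsFiniteMeasure P] (hP : HasIndepCoordIncrements P)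
    (ξ : EuclideanSpace ℝ (Fin d)) {s u t : unitInterval} (hsu : s ≤ u) (hut : u ≤ t) :
    charFun (P.map (fun ω => ω t - ω s)) ξ =
      charFun (P.map (fun ω => ω u - ω s)) ξ * charFun (P.map (fun ω => ω t - ω u)) ξ := by
  have hs := measurable_path_eval (d := d) s
  have hu := measurable_path_eval (d := d) u
  have ht := measurable_path_eval (d := d) t
  have hind : IndepFun (fun ω : WW d => ω u - ω s) (fun ω => ω t - ω u) P :=
    hP.indepFun hut (Measurable.sub (measurable_coordF_eval le_rfl) (measurable_coordF_eval hsu))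
      measurable_id
  rw [← Pi.mul_apply, ← hind.charFun_map_fun_add_eq_mul (by fun_prop) (by fun_prop)]
  simp

/-- Two Wiener measures whose increments have the same covariance structure have the same
increment laws. -/
lemma IsWienerMeasure.map_increment_eq (hP : IsWienerMeasure P) (hP' : IsWienerMeasure P')
    (hvar : ∀ ξ (s t : unitInterval), s ≤ t →
      ∫ ω, pathIncr ξ s t ω ^ 2 ∂P = ∫ ω, pathIncr ξ s t ω ^ 2 ∂P')
    {s t : unitInterval} (hst : s ≤ t) :
    P.map (fun ω => ω t - ω s) = P'.map (fun ω => ω t - ω s) := by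
  have := hP.1
  have := hP'.1
  have hmeas : ∀ s t, Measurable (fun ω : WW d => ω t - ω s) := fun s t =>
    (measurable_path_eval t).sub (measurable_path_eval s)
  have := Measure.isProbabilityMeasure_map (μ := P) (hmeas s t).aemeasurable
  have := Measure.isProbabilityMeasure_map (μ := P') (hmeas s t).aemeasurable
  refine Measure.ext_of_charFun (funext fun ξ => ?_)
  obtain ⟨C, hC, h⟩ := IsWienerMeasure.norm_charFun_sub_le ξ
  let φ : Measure (WW d) → unitInterval → unitInterval → ℂ := fun Q s t =>
    charFun (Q.map (fun ω => ω t - ω s)) ξ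
  have hφ1 : ∀ Q : Measure (WW d), IsProbabilityMeasure Q → ∀ s t, ‖φ Q s t‖ ≤ 1 := by
    intro Q _ s t
    have := Measure.isProbabilityMeasure_map (μ := Q) (hmeas s t).aemeasurable
    exact norm_charFun_le_one ξ
  have hsub : ∀ s u t : unitInterval, s ≤ u → u ≤ t →
      ‖φ P s t - φ P' s t‖ ≤ ‖φ P s u - φ P' s u‖ + ‖φ P u t - φ P' u t‖ := by
    intro s u t hsu hut
    have e1 : φ P s t = φ P s u * φ P u t :=
      hP.hasIndepCoordIncrements.charFun_eq_mul ξ hsu hut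
    have e2 : φ P' s t = φ P' s u * φ P' u t :=
      hP'.hasIndepCoordIncrements.charFun_eq_mul ξ hsu hut
    have e3 : φ P s t - φ P' s t =
        (φ P s u - φ P' s u) * φ P u t + φ P' s u * (φ P u t - φ P' u t) := by
      rw [e1, e2]; ring
    rw [e3]
    refine (norm_add_le _ _).trans (add_le_add ?_ ?_)
    · rw [norm_mul]
      exact mul_le_of_le_one_right (norm_nonneg _) (hφ1 P ‹_› u t)
    · rw [norm_mul]
      exact mul_le_of_le_one_left (norm_nonneg _) (hφ1 P' ‹_› s u)
  have hiter : ∀ n : ℕ, ∀ s t : unitInterval, s ≤ t →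
      ‖φ P s t - φ P' s t‖ ≤ 2 * C * √((t : ℝ) - s) ^ 3 * (√2)⁻¹ ^ n := by
    intro n
    induction n with
    | zero =>
      intro s t hst
      have h1 := h P hP s t hst
      have h2 := h P' hP' s t hst
      rw [hvar ξ s t hst] at h1
      set b : ℂ := 1 - (∫ ω, pathIncr ξ s t ω ^ 2 ∂P' : ℝ) / 2
      have := norm_sub_le_norm_sub_add_norm_sub (φ P s t) b (φ P' s t)
      rw [norm_sub_rev b (φ P' s t)] at this
      simp only [φ, pow_zero, mul_one] at this ⊢
      linarith
    | succ n ih =>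
      intro s t hst
      have hst' : (s : ℝ) ≤ t := hst
      let u : unitInterval := ⟨((s : ℝ) + t) / 2, by
        have := s.2.1; have := t.2.1; linarith, by have := s.2.2; have := t.2.2; linarith⟩
      have hsu : s ≤ u := by change (s : ℝ) ≤ (s + t) / 2; linarith
      have hut : u ≤ t := by change ((s : ℝ) + t) / 2 ≤ t; linarith
      have h1 := ih s u hsu
      have h2 := ih u t hut
      have e1 : (u : ℝ) - s = (t - s) / 2 := by change ((s : ℝ) + t) / 2 - s = _; ring
      have e2 : (t : ℝ) - u = (t - s) / 2 := by change (t : ℝ) - (s + t) / 2 = _; ring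
      rw [e1, Real.sqrt_div (by linarith)] at h1
      rw [e2, Real.sqrt_div (by linarith)] at h2
      refine (hsub s u t hsu hut).trans ((add_le_add h1 h2).trans_eq ?_)
      have h2' : √(2 : ℝ) ^ 2 = 2 := Real.sq_sqrt (by norm_num)
      have h3 : (√(2 : ℝ))⁻¹ ^ 2 = 2⁻¹ := by rw [inv_pow, h2']
      rw [div_eq_mul_inv, mul_pow, pow_succ _ n]
      linear_combination
        (4 * C * √((t : ℝ) - s) ^ 3 * (√(2 : ℝ))⁻¹ ^ n * (√(2 : ℝ))⁻¹) * h3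
  have hlim : Tendsto (fun n : ℕ => 2 * C * √((t : ℝ) - s) ^ 3 * (√2)⁻¹ ^ n) atTop (𝓝 0) := by
    have h2 : (√(2 : ℝ))⁻¹ < 1 := inv_lt_one_of_one_lt₀ (Real.lt_sqrt_of_sq_lt (by norm_num))
    simpa using (tendsto_pow_atTop_nhds_zero_of_lt_one (by positivity) h2).const_mul
      (2 * C * √((t : ℝ) - s) ^ 3)
  exact sub_eq_zero.1 (norm_le_zero_iff.1 (ge_of_tendsto' hlim fun n => hiter n s t hst))

end CharacteristicFunction

section QuadraticVariation

variable {d : ℕ}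

/-- The uniform partition of `[s, t]` into `n + 1` intervals. -/
def meshPoint (s t : unitInterval) (n k : ℕ) : unitInterval :=
  projIcc 0 1 zero_le_one ((s : ℝ) + (t - s) * (k / (n + 1)))

lemma coe_meshPoint {s t : unitInterval} (hst : s ≤ t) {n k : ℕ} (hk : k ≤ n + 1) :
    (meshPoint s t n k : ℝ) = s + (t - s) * (k / (n + 1)) := by
  have hst' : (s : ℝ) ≤ t := hst
  have hk0 : (0 : ℝ) ≤ k / (n + 1) := by positivity
  have hk1 : (k : ℝ) / (n + 1) ≤ 1 := by
    rw [div_le_one (by positivity)]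
    exact_mod_cast hk
  have hs := s.2.1
  have ht := t.2.2
  rw [meshPoint, projIcc_of_mem]
  constructor <;> nlinarith

lemma meshPoint_mono {s t : unitInterval} (hst : s ≤ t) (n : ℕ) : Monotone (meshPoint s t n) := by
  intro k l hkl
  have hst' : (0 : ℝ) ≤ t - s := sub_nonneg.2 hst
  refine monotone_projIcc _ ?_
  gcongr

lemma meshPoint_zero (s t : unitInterval) (n : ℕ) : meshPoint s t n 0 = s := by
  simp [meshPoint, projIcc_val]

lemma meshPoint_last (s t : unitInterval) (n : ℕ) : meshPoint s t n (n + 1) = t := by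
  have : ((n + 1 : ℕ) : ℝ) / (n + 1) = 1 := by
    push_cast
    exact div_self (by positivity)
  rw [meshPoint, this]
  simp [projIcc_val]

lemma meshPoint_succ_sub {s t : unitInterval} (hst : s ≤ t) {n k : ℕ} (hk : k < n + 1) :
    (meshPoint s t n (k + 1) : ℝ) - meshPoint s t n k = (t - s) / (n + 1) := by
  rw [coe_meshPoint hst hk, coe_meshPoint hst hk.le]
  push_cast
  ring

/-- The increments along `ξ` of a path over the uniform partition of `[s, t]`. -/
def meshIncr (ξ : EuclideanSpace ℝ (Fin d)) (s t : unitInterval) (n : ℕ) (ω : WW d) :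
    EuclideanSpace ℝ (Fin (n + 1)) :=
  WithLp.toLp 2 fun k => pathIncr ξ (meshPoint s t n k) (meshPoint s t n (k + 1)) ω

lemma norm_meshIncr_sq (ξ : EuclideanSpace ℝ (Fin d)) (s t : unitInterval) (n : ℕ) (ω : WW d) :
    ‖meshIncr ξ s t n ω‖ ^ 2 = ∑ k ∈ Finset.range (n + 1),
      pathIncr ξ (meshPoint s t n k) (meshPoint s t n (k + 1)) ω ^ 2 := by
  rw [EuclideanSpace.norm_sq_eq, Finset.sum_range]
  simp [meshIncr]

lemma meshIncr_sub (ξ : EuclideanSpace ℝ (Fin d)) (s t : unitInterval) (n : ℕ) (ω ω' : WW d) :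
    meshIncr ξ s t n (ω - ω') = meshIncr ξ s t n ω - meshIncr ξ s t n ω' := by
  ext k
  simp only [meshIncr, pathIncr, PiLp.sub_apply, ContinuousMap.sub_apply, ← inner_sub_right]
  congr 1
  abel

lemma norm_meshIncr_sq_le (ξ : EuclideanSpace ℝ (Fin d)) {s t : unitInterval} (hst : s ≤ t)
    (n : ℕ) {h : WW d} (hh : cmNormSq h ≠ ⊤) :
    ‖meshIncr ξ s t n h‖ ^ 2 ≤ ‖ξ‖ ^ 2 * (cmNormSq h).toReal * ((t - s) / (n + 1)) := by
  rcases hst.eq_or_lt with rfl | hlt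
  · have : ∀ k, meshPoint s s n k = s := fun k => by simp [meshPoint, projIcc_val]
    rw [norm_meshIncr_sq]
    simp [pathIncr, this]
  have hδ : (0 : ℝ) < (t - s) / (n + 1) := div_pos (sub_pos.2 hlt) (by positivity)
  set δ : ℝ := (t - s) / (n + 1) with hδ_def
  have hsum : ∑ k ∈ Finset.range (n + 1),
      ‖h (meshPoint s t n (k + 1)) - h (meshPoint s t n k)‖ ^ 2 / δ ≤ (cmNormSq h).toReal := by
    rw [← ENNReal.ofReal_le_iff_le_toReal hh, ENNReal.ofReal_sum_of_nonneg fun k _ => by positivity,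
      Finset.sum_range]
    refine le_trans (le_of_eq ?_) (le_iSup_of_le (n + 1)
      (le_iSup₂_of_le (fun k : Fin (n + 1 + 1) => meshPoint s t n k)
        (fun k l hkl => meshPoint_mono hst n hkl) le_rfl))
    refine Finset.sum_congr rfl fun k _ => ?_
    rw [hδ_def, ← meshPoint_succ_sub hst k.2]
    simp
  calc ‖meshIncr ξ s t n h‖ ^ 2
      ≤ ∑ k ∈ Finset.range (n + 1), ‖ξ‖ ^ 2 * δ *
          (‖h (meshPoint s t n (k + 1)) - h (meshPoint s t n k)‖ ^ 2 / δ) := by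
        rw [norm_meshIncr_sq]
        refine Finset.sum_le_sum fun k _ => ?_
        rw [mul_assoc, mul_div_cancel₀ _ hδ.ne', ← mul_pow]
        exact sq_le_sq' (neg_le_of_abs_le (abs_real_inner_le_norm _ _)) (real_inner_le_norm _ _)
    _ ≤ ‖ξ‖ ^ 2 * (cmNormSq h).toReal * δ := by
        rw [← Finset.mul_sum, mul_right_comm]
        gcongr

lemma tendsto_norm_meshIncr_of_cmNormSq_ne_top (ξ : EuclideanSpace ℝ (Fin d))
    {s t : unitInterval} (hst : s ≤ t) {h : WW d} (hh : cmNormSq h ≠ ⊤) :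
    Tendsto (fun n => ‖meshIncr ξ s t n h‖) atTop (𝓝 0) := by
  have h1 : Tendsto (fun n : ℕ => ‖ξ‖ ^ 2 * (cmNormSq h).toReal * (((t : ℝ) - s) / (n + 1))) atTop
      (𝓝 0) := by
    have := (tendsto_one_div_add_atTop_nhds_zero_nat (𝕜 := ℝ)).const_mul
      (‖ξ‖ ^ 2 * (cmNormSq h).toReal * ((t : ℝ) - s))
    simpa [mul_div_assoc, div_eq_mul_inv, mul_assoc] using this
  have h2 := squeeze_zero (fun n => sq_nonneg _) (fun n => norm_meshIncr_sq_le ξ hst n hh) h1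
  simpa using h2.sqrt

namespace IsWienerMeasure

variable {P : Measure (WW d)}

lemma indepFun_pathIncr (hP : IsWienerMeasure P) (ξ : EuclideanSpace ℝ (Fin d))
    {s t : unitInterval} (hst : s ≤ t) (n : ℕ) {i j : ℕ} (hij : i < j) :
    IndepFun (pathIncr ξ (meshPoint s t n i) (meshPoint s t n (i + 1)))
      (pathIncr ξ (meshPoint s t n j) (meshPoint s t n (j + 1))) P := by
  have hm := meshPoint_mono hst n
  refine hP.hasIndepCoordIncrements.indepFun (hm j.le_succ) ?_
    (g := fun x => inner ℝ ξ x) (Measurable.inner measurable_const measurable_id)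
  exact Measurable.inner measurable_const
    ((measurable_coordF_eval (hm hij)).sub (measurable_coordF_eval (hm hij.le)))

lemma pairwise_indepFun_pathIncr (hP : IsWienerMeasure P) (ξ : EuclideanSpace ℝ (Fin d))
    {s t : unitInterval} (hst : s ≤ t) (n : ℕ) :
    Pairwise fun i j => IndepFun (pathIncr ξ (meshPoint s t n i) (meshPoint s t n (i + 1)))
      (pathIncr ξ (meshPoint s t n j) (meshPoint s t n (j + 1))) P := by
  intro i j hij
  rcases hij.lt_or_gt with h | h
  · exact hP.indepFun_pathIncr ξ hst n h
  · exact (hP.indepFun_pathIncr ξ hst n h).symm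

lemma integral_norm_meshIncr_sq (hP : IsWienerMeasure P) (ξ : EuclideanSpace ℝ (Fin d))
    {s t : unitInterval} (hst : s ≤ t) (n : ℕ) :
    ∫ ω, ‖meshIncr ξ s t n ω‖ ^ 2 ∂P = ∫ ω, pathIncr ξ s t ω ^ 2 ∂P := by
  have := hP.1
  have hm := meshPoint_mono hst n
  have hvar : ∀ {a b : unitInterval}, a ≤ b →
      Var[pathIncr ξ a b; P] = ∫ ω, pathIncr ξ a b ω ^ 2 ∂P := fun hab => by
    rw [variance_of_integral_eq_zero (measurable_pathIncr ξ _ _).aemeasurable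
      (hP.integral_pathIncr ξ hab)]
  have hsum : pathIncr ξ s t = ∑ k ∈ Finset.range (n + 1),
      pathIncr ξ (meshPoint s t n k) (meshPoint s t n (k + 1)) := by
    ext ω
    simp only [pathIncr, Finset.sum_apply, ← inner_sum]
    rw [Finset.sum_range_sub (fun k => ω (meshPoint s t n k)), meshPoint_zero, meshPoint_last]
  simp_rw [norm_meshIncr_sq]
  rw [integral_finsetSum _ fun k _ => (hP.memLp_pathIncr ξ (hm k.le_succ) 2).integrable_sq,
    ← hvar hst, hsum, IndepFun.variance_sum
      (fun k _ => hP.memLp_pathIncr ξ (hm k.le_succ) 2)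
      (fun i _ j _ hij => hP.pairwise_indepFun_pathIncr ξ hst n hij)]
  exact Finset.sum_congr rfl fun k _ => (hvar (hm k.le_succ)).symm

lemma exists_variance_norm_meshIncr_sq_le (hP : IsWienerMeasure P)
    (ξ : EuclideanSpace ℝ (Fin d)) {s t : unitInterval} (hst : s ≤ t) :
    ∃ C : ℝ, ∀ n : ℕ, MemLp (fun ω => ‖meshIncr ξ s t n ω‖ ^ 2) 2 P ∧
      Var[fun ω => ‖meshIncr ξ s t n ω‖ ^ 2; P] ≤ C / (n + 1) := by
  have := hP.1
  obtain ⟨C, hC, h⟩ := exists_integral_abs_pow_le (d := d) ξ (p := 4) (by norm_num)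
  refine ⟨C * (t - s) ^ 2, fun n => ?_⟩
  have hm := meshPoint_mono hst n
  have hst' : (0 : ℝ) ≤ t - s := sub_nonneg.2 hst
  let Z : ℕ → WW d → ℝ := fun k => pathIncr ξ (meshPoint s t n k) (meshPoint s t n (k + 1))
  have hZm : ∀ k, Measurable (Z k) := fun k => measurable_pathIncr ξ _ _
  have hZ : ∀ k, MemLp (fun ω => Z k ω ^ 2) 2 P := fun k => by
    refine (memLp_two_iff_integrable_sq ((hZm k).pow_const 2).aestronglyMeasurable).2 ?_
    have := (hP.memLp_pathIncr ξ (hm k.le_succ) (4 : ℕ)).integrable_norm_pow (by simp)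
    refine this.congr (ae_of_all _ fun ω => ?_)
    simp only [Real.norm_eq_abs, ← pow_mul]
    exact Even.pow_abs (by decide) _
  have heq : (fun ω => ‖meshIncr ξ s t n ω‖ ^ 2) =
      ∑ k ∈ Finset.range (n + 1), fun ω => Z k ω ^ 2 := by
    ext ω
    simp [norm_meshIncr_sq, Z]
  rw [heq]
  refine ⟨memLp_finsetSum' _ fun k _ => hZ k, ?_⟩
  rw [IndepFun.variance_sum (fun k _ => hZ k) fun i _ j _ hij =>
    (hP.pairwise_indepFun_pathIncr ξ hst n hij).comp (measurable_id.pow_const 2)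
      (measurable_id.pow_const 2)]
  have hbound : ∀ k ∈ Finset.range (n + 1),
      Var[fun ω => Z k ω ^ 2; P] ≤ C * (((t : ℝ) - s) / (n + 1)) ^ 2 := fun k hk => by
    refine (variance_le_expectation_sq ((hZm k).pow_const 2).aestronglyMeasurable).trans ?_
    have h4 := h P hP _ _ (hm k.le_succ)
    rw [meshPoint_succ_sub hst (Finset.mem_range.1 hk)] at h4
    calc ∫ ω, ((fun ω => Z k ω ^ 2) ^ 2) ω ∂P = ∫ ω, |Z k ω| ^ 4 ∂P := by
          congr 1 with ω
          rw [Even.pow_abs (by decide)]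
          simp [← pow_mul]
      _ ≤ _ := h4
      _ = _ := by
          rw [show 4 = 2 * 2 from rfl, pow_mul, Real.sq_sqrt (by positivity)]
  refine (Finset.sum_le_sum hbound).trans_eq ?_
  have : ((n : ℝ) + 1) ≠ 0 := by positivity
  simp only [Finset.sum_const, Finset.card_range, nsmul_eq_mul]
  push_cast
  field_simp

/-- Under a Wiener measure, the quadratic variation along `ξ` converges in probability. -/
lemma tendstoInMeasure_norm_meshIncr_sq (hP : IsWienerMeasure P)
    (ξ : EuclideanSpace ℝ (Fin d)) {s t : unitInterval} (hst : s ≤ t) :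
    TendstoInMeasure P (fun n ω => ‖meshIncr ξ s t n ω‖ ^ 2) atTop
      (fun _ => ∫ ω, pathIncr ξ s t ω ^ 2 ∂P) := by
  have := hP.1
  obtain ⟨C, hC⟩ := hP.exists_variance_norm_meshIncr_sq_le ξ hst
  rw [tendstoInMeasure_iff_norm]
  intro ε hε
  have hlim : Tendsto (fun n : ℕ => ENNReal.ofReal (C / (n + 1) / ε ^ 2)) atTop (𝓝 0) := by
    rw [← ENNReal.ofReal_zero]
    refine ENNReal.tendsto_ofReal ?_
    have := (tendsto_one_div_add_atTop_nhds_zero_nat (𝕜 := ℝ)).const_mul (C / ε ^ 2)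
    simpa [div_eq_mul_inv, mul_assoc, mul_comm, mul_left_comm] using this
  refine tendsto_of_tendsto_of_tendsto_of_le_of_le tendsto_const_nhds hlim
    (fun n => zero_le) fun n => ?_
  have := meas_ge_le_variance_div_sq (hC n).1 hε
  rw [hP.integral_norm_meshIncr_sq ξ hst n] at this
  refine this.trans (ENNReal.ofReal_le_ofReal ?_)
  have := (hC n).2
  gcongr

end IsWienerMeasure

/-- Almost sure equality up to Cameron–Martin paths forces equality of the covariances. -/
lemma integral_pathIncr_sq_eq {μ ν : Measure (WW d)} [IsProbabilityMeasure ν]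
    (hμ : IsWienerMeasure μ) (hac : ν ≪ μ) {V : WW d → WW d} (hVm : Measurable V)
    (hH : ∀ᵐ ω ∂ν, cmNormSq (V ω - ω) ≠ ⊤) (hV : IsWienerMeasure (ν.map V))
    (ξ : EuclideanSpace ℝ (Fin d)) {s t : unitInterval} (hst : s ≤ t) :
    ∫ ω, pathIncr ξ s t ω ^ 2 ∂(ν.map V) = ∫ ω, pathIncr ξ s t ω ^ 2 ∂μ := by
  obtain ⟨u, hu, hu'⟩ := (hμ.tendstoInMeasure_norm_meshIncr_sq ξ hst).exists_seq_tendsto_ae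
  obtain ⟨v, hv, hv'⟩ := TendstoInMeasure.exists_seq_tendsto_ae
    (fun ε hε => (hV.tendstoInMeasure_norm_meshIncr_sq ξ hst ε hε).comp hu.tendsto_atTop)
  have h1 := hu'.filter_mono hac.ae_le
  have h2 := ae_of_ae_map hVm.aemeasurable hv'
  obtain ⟨ω, h1, h2, h3⟩ := (h1.and (h2.and hH)).exists
  have h1 := (h1.comp hv.tendsto_atTop).sqrt
  have h2 := h2.sqrt
  have hsub := (tendsto_norm_meshIncr_of_cmNormSq_ne_top ξ hst h3).comp
    (hu.tendsto_atTop.comp hv.tendsto_atTop)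
  have hlim : Tendsto (fun n => ‖meshIncr ξ s t (u (v n)) (V ω)‖ - ‖meshIncr ξ s t (u (v n)) ω‖)
      atTop (𝓝 0) := by
    refine squeeze_zero_norm (fun n => ?_) hsub
    simp only [Function.comp_apply, meshIncr_sub]
    exact abs_norm_sub_norm_le _ _
  simp only [Function.comp_apply, Real.sqrt_sq (norm_nonneg _)] at h1 h2
  have := tendsto_nhds_unique (h2.sub h1) hlim
  refine (Real.sqrt_inj ?_ ?_).1 (sub_eq_zero.1 this) <;>
    exact integral_nonneg fun ω => sq_nonneg _

/-- The image of `ν` under its Girsanov shift is the Wiener measure. -/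
lemma IsGirsanovShift.map_eq {μ ν : Measure (WW d)} [IsProbabilityMeasure ν]
    (hμ : IsWienerMeasure μ) (hac : ν ≪ μ) {V : WW d → WW d} (hV : IsGirsanovShift ν V) :
    ν.map V = μ := by
  obtain ⟨hVm, hH, hB⟩ := hV
  have hW : IsWienerMeasure (ν.map V) :=
    hB.isWienerMeasure_map (fun s t hst => aug_mono (coordF_mono hst)) hVm
  have := hμ.1
  have := hW.1
  exact eq_of_map_increments_eq hW.2.2.1 hμ.2.2.1 hW.hasIndepCoordIncrements
    hμ.hasIndepCoordIncrements fun s t hst => hW.map_increment_eq hμ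
      (fun ξ s t hst => integral_pathIncr_sq_eq hμ hac hVm hH hW ξ hst) hst

end QuadraticVariation

section Causality

variable {d : ℕ}

lemma IsBMWrt.mono {Ω : Type*} [MeasurableSpace Ω] {P : Measure Ω}
    {𝒜 ℬ : unitInterval → MeasurableSpace Ω} {Y : Ω → WW d} (h : IsBMWrt 𝒜 Y P)
    (hle : ∀ t, ℬ t ≤ 𝒜 t) (hY : ∀ t, Measurable[ℬ t] (fun ω => Y ω t)) : IsBMWrt ℬ Y P :=
  ⟨hY, h.2.1, fun s t hst =>
    ⟨(h.2.2 s t hst).1, indep_of_indep_of_le_right (h.2.2 s t hst).2 (hle s)⟩⟩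

lemma IsBMWrt.measurable_coordF {Ω : Type*} [MeasurableSpace Ω] {P : Measure Ω}
    {𝒜 : unitInterval → MeasurableSpace Ω} {Y : Ω → WW d} (h : IsBMWrt 𝒜 Y P)
    (h𝒜 : Monotone 𝒜) (t : unitInterval) : Measurable[𝒜 t, coordF d t] Y :=
  measurable_coordF_iff.2 fun s hs => (h.1 s).mono (h𝒜 hs) le_rfl

lemma monotone_aug_coordF (ν : Measure (WW d)) : Monotone fun t => aug ν (coordF d t) :=
  fun _ _ hst => aug_mono (coordF_mono hst)

/-- A finite measure on path space is determined by its values on intersections of a past event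
and an event of the future increments. -/
lemma ext_of_past_future {m₁ m₂ : Measure (WW d)} [IsFiniteMeasure m₁] (t : unitInterval)
    (h : ∀ A B, MeasurableSet[coordF d t] A → MeasurableSet B →
      m₁ (A ∩ futureShift t ⁻¹' B) = m₂ (A ∩ futureShift t ⁻¹' B)) : m₁ = m₂ := by
  let S : Set (Set (WW d)) :=
    {s | ∃ A B, MeasurableSet[coordF d t] A ∧ MeasurableSet B ∧ A ∩ futureShift t ⁻¹' B = s}
  have hpast : coordF d t ≤ MeasurableSpace.generateFrom S := fun A hA =>
    MeasurableSpace.measurableSet_generateFrom ⟨A, univ, hA, .univ, by simp⟩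
  have hfuture : Measurable[MeasurableSpace.generateFrom S] (futureShift (d := d) t) :=
    fun B hB => MeasurableSpace.measurableSet_generateFrom
      ⟨univ, B, @MeasurableSet.univ _ (coordF d t), hB, by simp⟩
  have hgen : (inferInstance : MeasurableSpace (WW d)) = MeasurableSpace.generateFrom S := by
    refine le_antisymm ?_ (MeasurableSpace.generateFrom_le ?_)
    · have : Measurable[MeasurableSpace.generateFrom S, coordF d 1] (fun ω => ω) := by
        refine measurable_coordF_iff.2 fun u _ => ?_
        have ht : Measurable[MeasurableSpace.generateFrom S] (fun ω : WW d => ω t) :=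
          (measurable_coordF_eval le_rfl).mono hpast le_rfl
        rcases le_total u t with hu | hu
        · exact (measurable_coordF_eval hu).mono hpast le_rfl
        · have : (fun ω : WW d => ω u) = fun ω => futureShift t ω u + ω t := by
            ext1 ω
            simp [futureShift, hu]
          rw [this]
          exact ((measurable_path_eval u).comp hfuture).add ht
      rw [coordF_one] at this
      exact fun s hs => this hs
    · rintro _ ⟨A, B, hA, hB, rfl⟩
      exact (coordF_le t A hA).inter (measurable_futureShift t hB)
  have hpi : IsPiSystem S := by
    rintro _ ⟨A, B, hA, hB, rfl⟩ _ ⟨A', B', hA', hB', rfl⟩ -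
    exact ⟨A ∩ A', B ∩ B', @MeasurableSet.inter _ (coordF d t) _ _ hA hA', hB.inter hB',
      by rw [preimage_inter, inter_inter_inter_comm]⟩
  refine ext_of_generate_finite S hgen hpi ?_ ?_
  · rintro _ ⟨A, B, hA, hB, rfl⟩
    exact h A B hA hB
  · simpa using h univ univ (@MeasurableSet.univ _ (coordF d t)) .univ

/-- If `V` is a Brownian motion for a filtration `𝒢` under `ν` with law `μ`, then the
`V`-conditional probability of an event of `𝒢 t` only depends on `V` up to time `t`. -/
lemma exists_ae_eq_measurable_coordF {μ ν : Measure (WW d)} [IsProbabilityMeasure ν]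
    (hμ : IsWienerMeasure μ) {V : WW d → WW d} (hVm : Measurable V) (hmap : ν.map V = μ)
    {𝒢 : unitInterval → MeasurableSpace (WW d)} (h𝒢 : Monotone 𝒢)
    (hle : ∀ t, 𝒢 t ≤ (inferInstance : MeasurableSpace (WW d))) (hV : IsBMWrt 𝒢 V ν)
    {t : unitInterval} {C : Set (WW d)} (hC : MeasurableSet[𝒢 t] C) {θ : WW d → ℝ≥0∞}
    (hθ : Measurable θ) (hCθ : ∀ A, MeasurableSet A → ν (V ⁻¹' A ∩ C) = ∫⁻ ω in A, θ ω ∂μ) :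
    ∃ g : WW d → ℝ≥0∞, Measurable[coordF d t] g ∧ θ =ᵐ[μ] g := by
  have := hμ.1
  have hct := coordF_le (d := d) t
  let m : Measure (WW d) := (ν.restrict C).map V
  have hm_apply : ∀ A, MeasurableSet A → m A = ν (V ⁻¹' A ∩ C) := fun A hA => by
    rw [Measure.map_apply hVm hA, Measure.restrict_apply (hVm hA)]
  have hm : m = μ.withDensity θ := Measure.ext fun A hA => by
    rw [hm_apply A hA, hCθ A hA, withDensity_apply _ hA]
  have hmμ : m ≪ μ := hm ▸ withDensity_absolutelyContinuous _ _
  have htrim : m.trim hct ≪ μ.trim hct := hmμ.trim hct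
  let g : WW d → ℝ≥0∞ := (m.trim hct).rnDeriv (μ.trim hct)
  have hg : Measurable[coordF d t] g := Measure.measurable_rnDeriv _ _
  have hg_apply : ∀ A, MeasurableSet[coordF d t] A → ∫⁻ ω in A, g ω ∂μ = m A := fun A hA => by
    rw [← trim_measurableSet_eq hct hA, ← Measure.setLIntegral_rnDeriv htrim A,
      restrict_trim hct _ hA, lintegral_trim hct hg]
  refine ⟨g, hg, ?_⟩
  have hind : Indep (MeasurableSpace.comap (fun ω => futureShift t (V ω)) inferInstance) (𝒢 t) ν :=
    hV.indep_futureShift h𝒢 hle hVm t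
  have hindμ : Indep (MeasurableSpace.comap (fun ω => futureShift t ω) inferInstance)
      (coordF d t) μ := hμ.2.indep_futureShift coordF_mono coordF_le measurable_id t
  have hmg : m = μ.withDensity g := by
    refine ext_of_past_future t fun A B hA hB => ?_
    have hBt := measurable_futureShift t hB
    have e1 : m (A ∩ futureShift t ⁻¹' B) = m A * μ (futureShift t ⁻¹' B) := by
      rw [hm_apply _ ((hct A hA).inter hBt), hm_apply _ (hct A hA), ← hmap,
        Measure.map_apply hVm hBt, mul_comm]
      refine Eq.trans ?_ ((Indep_iff _ _ _).1 hind _ _ ⟨B, hB, rfl⟩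
        (@MeasurableSet.inter _ (𝒢 t) _ _ (hV.measurable_coordF h𝒢 t hA) hC))
      congr 1
      ext ω
      simp only [mem_inter_iff, mem_preimage]
      tauto
    rw [e1, withDensity_apply _ ((hct A hA).inter hBt), ← hg_apply A hA]
    have hD : Measurable[MeasurableSpace.comap (fun ω => futureShift (d := d) t ω) inferInstance]
        ((futureShift t ⁻¹' B).indicator (1 : WW d → ℝ≥0∞)) :=
      (measurable_const.indicator hB : Measurable (B.indicator (1 : WW d → ℝ≥0∞))).comp
        (comap_measurable _)
    have := lintegral_mul_eq_lintegral_mul_lintegral_of_independent_measurableSpace hct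
      (measurable_futureShift t).comap_le hindμ.symm (hg.indicator hA) hD
    rw [lintegral_indicator (hct A hA), lintegral_indicator_one hBt] at this
    rw [← this, ← lintegral_indicator ((hct A hA).inter hBt)]
    congr 1 with ω
    by_cases h1 : ω ∈ A <;> by_cases h2 : ω ∈ futureShift t ⁻¹' B <;> simp_all
  have h := (withDensity_eq_iff hθ.aemeasurable (hg.mono hct le_rfl).aemeasurable ?_).1
    (hm.symm.trans hmg)
  · exact h
  · have := hCθ univ .univ
    rw [setLIntegral_univ] at this
    rw [← this]
    exact measure_ne_top _ _

lemma IsGirsanovShift.causalPlan_prodMk {ν : Measure (WW d)} [IsProbabilityMeasure ν]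
    {V : WW d → WW d} (hV : IsGirsanovShift ν V) :
    CausalPlan (coordF d) (coordF d) ν (ν.map (fun ω => (ω, V ω))) := by
  obtain ⟨hVm, -, hB⟩ := hV
  refine ⟨?_, Kernel.deterministic V hVm, ⟨inferInstance, fun A B hA hB => ?_⟩,
    fun t C hC => ?_⟩
  · rw [Measure.fst_map_prodMk hVm, Measure.map_id']
  · rw [Measure.map_apply (by fun_prop) (hA.prod hB)]
    simp_rw [Kernel.deterministic_apply' hVm _ hB]
    have : (fun ω => B.indicator (fun _ => (1 : ℝ≥0∞)) (V ω)) = (V ⁻¹' B).indicator 1 := rfl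
    rw [this, lintegral_indicator_one (hVm hB), Measure.restrict_apply (hVm hB), inter_comm]
    rfl
  · simp_rw [Kernel.deterministic_apply' hVm _ (coordF_le t C hC)]
    exact Measurable.comp (measurable_const.indicator hC)
      (hB.measurable_coordF (monotone_aug_coordF ν) t)

lemma IsGirsanovShift.causalPlan_prodMk_swap {μ ν : Measure (WW d)} [IsProbabilityMeasure ν]
    (hμ : IsWienerMeasure μ) (hac : ν ≪ μ) {V : WW d → WW d} (hV : IsGirsanovShift ν V) :
    CausalPlan (coordF d) (coordF d) μ (ν.map (fun ω => (V ω, ω))) := by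
  have hmap := hV.map_eq hμ hac
  obtain ⟨hVm, -, hB⟩ := hV
  have hprod : ∀ A B, MeasurableSet A → MeasurableSet B →
      ν (V ⁻¹' A ∩ B) = ∫⁻ ω in A, condDistrib (fun ω => ω) V ν ω B ∂μ := fun A B hA hB => by
    have := congrArg (fun m : Measure (WW d × WW d) => m (A ×ˢ B))
      (compProd_map_condDistrib (X := V) (Y := fun ω => ω) (μ := ν) (mβ := inferInstance)
        (by fun_prop))
    rw [Measure.compProd_apply_prod hA hB, hmap,
      Measure.map_apply (by fun_prop) (hA.prod hB)] at this
    exact this.symm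
  refine ⟨?_, condDistrib (fun ω => ω) V ν, ⟨inferInstance, fun A B hA hB => ?_⟩,
    fun t C hC => ?_⟩
  · rw [Measure.fst_map_prodMk measurable_id', hmap]
  · rw [← hprod A B hA hB, Measure.map_apply (by fun_prop) (hA.prod hB)]
    rfl
  · let 𝒢 : unitInterval → MeasurableSpace (WW d) := fun s =>
      coordF d s ⊔ (coordF d s).comap V
    have h𝒢 : Monotone 𝒢 := fun s t hst =>
      sup_le_sup (coordF_mono hst) (MeasurableSpace.comap_mono (coordF_mono hst))
    have hle : ∀ s, 𝒢 s ≤ (inferInstance : MeasurableSpace (WW d)) := fun s =>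
      sup_le (coordF_le s) ((MeasurableSpace.comap_mono (coordF_le s)).trans hVm.comap_le)
    have hB𝒢 : IsBMWrt 𝒢 V ν := by
      refine hB.mono (fun s => sup_le le_aug
        (hB.measurable_coordF (monotone_aug_coordF ν) s).comap_le) fun s => ?_
      have h1 : Measurable[(coordF d s).comap V, coordF d s] V := comap_measurable V
      exact ((measurable_coordF_eval le_rfl).comp h1).mono le_sup_right le_rfl
    obtain ⟨g, hg, hgeq⟩ := exists_ae_eq_measurable_coordF hμ hVm hmap h𝒢 hle hB𝒢
      (t := t) (C := C) ((le_sup_left : coordF d t ≤ 𝒢 t) C hC)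
      (Kernel.measurable_coe _ (coordF_le t C hC)) fun A hA => hprod A C hA (coordF_le t C hC)
    exact hg.aug_of_ae_eq hgeq

lemma IsBMWrt.comp_of_map_eq {ν : Measure (WW d)} {V : WW d → WW d} (hVm : Measurable V)
    (hV : IsBMWrt (fun t => aug ν (coordF d t)) V ν) {Ω : Type*} [MeasurableSpace Ω]
    {P : Measure Ω} {X : Ω → WW d} (hX : Measurable X) (hmap : P.map X = ν) :
    IsBMWrt (fun t => aug P (MeasurableSpace.comap X (coordF d t))) (fun ω => V (X ω)) P := by
  subst hmap
  have hadapt : ∀ t, Measurable[aug P (MeasurableSpace.comap X (coordF d t))]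
      (fun ω => V (X ω) t) := fun t B hB => by
    have : MeasurableSet[aug (P.map X) (coordF d t)] ((fun ω => V ω t) ⁻¹' B) := hV.1 t hB
    exact measurableSet_aug_preimage hX this
  have h0 : ∀ᵐ ω ∂P, V (X ω) 0 = 0 := ae_of_ae_map hX.aemeasurable hV.2.1
  refine ⟨hadapt, h0, fun s t hst => ⟨fun i => ?_, ?_⟩⟩
  · have hs : Measurable (fun ω => V ω s) := (measurable_path_eval s).comp hVm
    have ht : Measurable (fun ω => V ω t) := (measurable_path_eval t).comp hVm
    have hst_meas : Measurable (fun ω => V ω t i - V ω s i) := by fun_prop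
    rw [← (hV.2.2 s t hst).1 i, Measure.map_map hst_meas hX]
    rfl
  · rw [Indep_iff]
    rintro _ A ⟨B, hB, rfl⟩ hA
    obtain ⟨_, ⟨C, hC, rfl⟩, hAC⟩ := measurableSet_aug_iff.1 hA
    have hincr : MeasurableSet ((fun ω => V ω t - V ω s) ⁻¹' B) :=
      (((measurable_path_eval t).sub (measurable_path_eval s)).comp hVm) hB
    have hind := (Indep_iff _ _ _).1 (hV.2.2 s t hst).2 _ C ⟨B, hB, rfl⟩ (le_aug C hC)
    rw [Measure.map_apply hX (hincr.inter (coordF_le s C hC)), Measure.map_apply hX hincr,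
      Measure.map_apply hX (coordF_le s C hC)] at hind
    rw [measure_congr ((ae_eq_refl _).inter hAC), measure_congr hAC]
    exact hind

end Causality

/-- for `ν ≪ μ` with Girsanov shift `V`, `(I_W × V)_* ν ∈ Π_c(ν, μ)` and
`(V × I_W)_* ν ∈ Π_c(μ, ν)`; moreover for any `X` with `X_* P = ν`, the process `V ∘ X`
is a Brownian motion with respect to the augmented filtration generated by `X`. -/
theorem girsanov_shift_causal
    {d : ℕ} (μ ν : Measure (WW d)) (hμ : IsWienerMeasure μ) [IsProbabilityMeasure ν]
    (hac : ν ≪ μ) (V : WW d → WW d) (hV : IsGirsanovShift ν V) :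
    (CausalPlan (coordF d) (coordF d) ν (ν.map (fun ω => (ω, V ω))) ∧
      (ν.map (fun ω => (ω, V ω))).snd = μ) ∧
    (CausalPlan (coordF d) (coordF d) μ (ν.map (fun ω => (V ω, ω))) ∧
      (ν.map (fun ω => (V ω, ω))).snd = ν) ∧
    (∀ (Ω : Type) (_ : MeasurableSpace Ω) (P : Measure Ω), IsProbabilityMeasure P →
      ∀ X : Ω → WW d, Measurable X → P.map X = ν →
        IsBMWrt (fun t => aug P (MeasurableSpace.comap X (coordF d t)))
          (fun ω => V (X ω)) P) := by
  refine ⟨⟨hV.causalPlan_prodMk, ?_⟩, ⟨hV.causalPlan_prodMk_swap hμ hac, ?_⟩,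
    fun Ω _ P _ X hX hXν => hV.2.2.comp_of_map_eq hV.1 hX hXν⟩
  · rw [Measure.snd_map_prodMk measurable_id', hV.map_eq hμ hac]
  · rw [Measure.snd_map_prodMk hV.1, Measure.map_id']
end
end
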